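/- arXiv:1005.2442 — 2 statements merged into one kernel-verified Lean document; each statement's English description precedes it below -/
import Mathlib

section
/- Let A = diag(λ₁,…,λ_n) with |λ₁| ≥ … ≥ |λ_n| > 1, let C ∈ ℂ^{m×n} with (C,A) detectable, and assume non-degeneracy: for every equi-modulus index set I = {j : |λ_j| = r} the submatrix of the columns of C indexed by I has rank |I|. Let Q = Σ₀ = I_n, R = I_m, let (γ_k) be i.i.d. Bernoulli with P(γ_k = 1) = p ∈ (0,1], let P_k be the associated Riccati recursion, and fix an integer q ≥ 1. Then sup_k E[P_k^q] is bounded if and only if p > 1 − |λ₁|^{−2q}, where P_k^q is the q-th matrix power of the Hermitian positive definite matrix P_k. -/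
open Matrix MeasureTheory ProbabilityTheory
open scoped ComplexOrder ENNReal

/-- One step of the lossy Riccati recursion:
`X ↦ A X Aᴴ + Q − γ · A X Cᴴ (C X Cᴴ + R)⁻¹ C X Aᴴ`. -/
noncomputable def riccStep {ι κ : Type} [Fintype ι] [Fintype κ] [DecidableEq ι] [DecidableEq κ]
    (A : Matrix ι ι ℂ) (C : Matrix κ ι ℂ)
    (Q : Matrix ι ι ℂ) (R : Matrix κ κ ℂ) (g : ℝ)
    (X : Matrix ι ι ℂ) : Matrix ι ι ℂ :=
  A * X * Aᴴ + Q - (g : ℂ) • (A * X * Cᴴ * (C * X * Cᴴ + R)⁻¹ * (C * X * Aᴴ))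

/-- The lossy Riccati recursion `P₀ = S0`, `P_{k+1} = riccStep (γ k) (P k)`. -/
noncomputable def ricc {ι κ : Type} [Fintype ι] [Fintype κ] [DecidableEq ι] [DecidableEq κ]
    (A : Matrix ι ι ℂ) (C : Matrix κ ι ℂ)
    (Q : Matrix ι ι ℂ) (R : Matrix κ κ ℂ) (S0 : Matrix ι ι ℂ) (γ : ℕ → ℝ) :
    ℕ → Matrix ι ι ℂ
  | 0 => S0
  | k + 1 => riccStep A C Q R (γ k) (ricc A C Q R S0 γ k)

/-- Loewner order: `X ≤ Y` iff `Y - X` is positive semidefinite. -/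
def loe {ι : Type} [Fintype ι] (X Y : Matrix ι ι ℂ) : Prop := (Y - X).PosSemidef

/-- Entrywise expectation of a random matrix. -/
noncomputable def matExp {Ω ι κ : Type} [MeasurableSpace Ω] (μ : Measure Ω)
    (X : Ω → Matrix ι κ ℂ) : Matrix ι κ ℂ :=
  Matrix.of fun i j => ∫ ω, X ω i j ∂μ

/-- `sup_k E[P_k]` is bounded: the entries are integrable and there is a Hermitian matrix `M`
dominating every `E[P_k]` in the Loewner order. -/
def EBounded {Ω ι : Type} [Fintype ι] [MeasurableSpace Ω] (μ : Measure Ω)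
    (P : ℕ → Ω → Matrix ι ι ℂ) : Prop :=
  (∀ k i j, Integrable (fun ω => P k ω i j) μ) ∧
  ∃ M : Matrix ι ι ℂ, M.IsHermitian ∧ ∀ k, loe (matExp μ (P k)) M

/-- PBH detectability of `(C, A)`. -/
def Detectable {ι κ : Type} [Fintype ι] [Fintype κ] [DecidableEq ι]
    (A : Matrix ι ι ℂ) (C : Matrix κ ι ℂ) : Prop :=
  ∀ z : ℂ, 1 ≤ ‖z‖ →
    (Matrix.fromRows (A - z • (1 : Matrix ι ι ℂ)) C).rank = Fintype.card ι

/-- Non-degeneracy: for each equi-modulus index set `{j | |d j| = r}` the corresponding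
columns of `C` are linearly independent (i.e. `rank C_I = |I|`). -/
def NonDeg {ι κ : Type} (d : ι → ℂ) (C : Matrix κ ι ℂ) : Prop :=
  ∀ r : ℝ, LinearIndependent ℂ
    (fun j : {j : ι // ‖d j‖ = r} => fun i : κ => C i j.1)

section Aux

/-- one step identity -/
lemma riccStep_decomp {ι κ : Type} [Fintype ι] [Fintype κ] [DecidableEq ι] [DecidableEq κ]
    (A : Matrix ι ι ℂ) (C : Matrix κ ι ℂ) (P : Matrix ι ι ℂ) (hS : IsUnit (C * P * Cᴴ + 1).det)
    (g : ℝ) (hg : g = 0 ∨ g = 1) (u : ι → ℂ) :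
    ∃ u' : ι → ℂ, riccStep A C 1 1 g P *ᵥ u = A *ᵥ (P *ᵥ u') + u ∧
      star u ⬝ᵥ (riccStep A C 1 1 g P *ᵥ u) = star u' ⬝ᵥ (P *ᵥ u')
        + (g : ℂ) * (star (C *ᵥ (P *ᵥ u')) ⬝ᵥ (C *ᵥ (P *ᵥ u'))) + star u ⬝ᵥ u := by
  rcases hg with rfl | rfl
  · refine ⟨Aᴴ *ᵥ u, ?_, ?_⟩
    · simp [riccStep, Matrix.add_mulVec, Matrix.mulVec_mulVec, Matrix.mul_assoc]
    · simp [riccStep, Matrix.add_mulVec, dotProduct_add, Matrix.star_mulVec,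
        Matrix.dotProduct_mulVec, Matrix.vecMul_vecMul, Matrix.mul_assoc]
  · set v := Aᴴ *ᵥ u with hv
    set S := C * P * Cᴴ + 1 with hSd
    set s := S⁻¹ *ᵥ (C *ᵥ (P *ᵥ v)) with hs
    have hSs : S *ᵥ s = C *ᵥ (P *ᵥ v) := by
      rw [hs, Matrix.mulVec_mulVec, Matrix.mul_nonsing_inv _ hS, Matrix.one_mulVec]
    have h1 : C *ᵥ (P *ᵥ (v - Cᴴ *ᵥ s)) = s := by
      have : S *ᵥ s = C *ᵥ (P *ᵥ (Cᴴ *ᵥ s)) + s := by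
        rw [hSd, Matrix.add_mulVec, Matrix.one_mulVec]
        simp [Matrix.mulVec_mulVec, Matrix.mul_assoc]
      rw [Matrix.mulVec_sub, Matrix.mulVec_sub, ← hSs, this]; simp
    have h2 : riccStep A C 1 1 1 P *ᵥ u = A *ᵥ (P *ᵥ (v - Cᴴ *ᵥ s)) + u := by
      have e : riccStep A C 1 1 1 P = A * P * Aᴴ + 1 - A * P * Cᴴ * S⁻¹ * (C * P * Aᴴ) := by
        simp only [riccStep, Complex.ofReal_one, one_smul, hSd]
      rw [e]
      clear_value S
      rw [hs, hv]
      simp only [Matrix.add_mulVec, Matrix.sub_mulVec, Matrix.mulVec_sub,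
        Matrix.mulVec_mulVec, Matrix.mul_assoc, Matrix.one_mulVec]
      abel
    refine ⟨v - Cᴴ *ᵥ s, h2, ?_⟩
    rw [h2, h1, dotProduct_add]
    congr 1
    have h3 : star u ⬝ᵥ (A *ᵥ (P *ᵥ (v - Cᴴ *ᵥ s))) = star v ⬝ᵥ (P *ᵥ (v - Cᴴ *ᵥ s)) := by
      rw [hv, Matrix.star_mulVec, Matrix.conjTranspose_conjTranspose, Matrix.dotProduct_mulVec]
    have h4 : star (Cᴴ *ᵥ s) ⬝ᵥ (P *ᵥ (v - Cᴴ *ᵥ s)) = star s ⬝ᵥ s := by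
      rw [Matrix.star_mulVec, Matrix.conjTranspose_conjTranspose, ← Matrix.dotProduct_mulVec, h1]
    have h5 : star v = star (v - Cᴴ *ᵥ s) + star (Cᴴ *ᵥ s) := by simp
    rw [h3, Complex.ofReal_one, one_mul, ← h4, ← add_dotProduct, ← h5]

lemma psd_S {ι κ : Type} [Fintype ι] [Fintype κ] [DecidableEq ι] [DecidableEq κ]
    (C : Matrix κ ι ℂ) (P : Matrix ι ι ℂ) (hP : P.PosSemidef) : (C * P * Cᴴ + 1).PosDef :=
  Matrix.PosDef.posSemidef_add (hP.mul_mul_conjTranspose_same C) Matrix.PosDef.one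

lemma riccStep_psd {ι κ : Type} [Fintype ι] [Fintype κ] [DecidableEq ι] [DecidableEq κ]
    (A : Matrix ι ι ℂ) (C : Matrix κ ι ℂ) (P : Matrix ι ι ℂ) (hP : P.PosSemidef)
    (g : ℝ) (hg : g = 0 ∨ g = 1) : (riccStep A C 1 1 g P).PosSemidef := by
  have hS := psd_S C P hP
  have hSu : IsUnit (C * P * Cᴴ + 1).det := (Matrix.isUnit_iff_isUnit_det _).1 hS.isUnit
  have hH : (riccStep A C 1 1 g P).IsHermitian := by
    have hPH : Pᴴ = P := hP.isHermitian
    have hSH : (C * P * Cᴴ + 1)ᴴ = C * P * Cᴴ + 1 := hS.isHermitian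
    unfold riccStep
    rw [Matrix.IsHermitian, Matrix.conjTranspose_sub, Matrix.conjTranspose_smul]
    simp only [Matrix.conjTranspose_add, Matrix.conjTranspose_mul, Matrix.conjTranspose_nonsing_inv,
      hPH, Matrix.conjTranspose_conjTranspose, Matrix.conjTranspose_one, Matrix.mul_assoc,
      RCLike.star_def, Complex.conj_ofReal]
  refine Matrix.PosSemidef.of_dotProduct_mulVec_nonneg hH fun u => ?_
  obtain ⟨u', -, h⟩ := riccStep_decomp A C P hSu g hg u
  rw [h]
  have hg0 : (0:ℂ) ≤ (g : ℂ) := by rcases hg with rfl | rfl <;> simp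
  exact add_nonneg (add_nonneg (hP.dotProduct_mulVec_nonneg _)
    (mul_nonneg hg0 (dotProduct_star_self_nonneg _))) (dotProduct_star_self_nonneg _)

lemma ricc_psd {ι κ : Type} [Fintype ι] [Fintype κ] [DecidableEq ι] [DecidableEq κ]
    (A : Matrix ι ι ℂ) (C : Matrix κ ι ℂ) (g : ℕ → ℝ) (hg : ∀ k, g k = 0 ∨ g k = 1) (k : ℕ) :
    (ricc A C 1 1 1 g k).PosSemidef := by
  induction k with
  | zero => exact Matrix.PosSemidef.one
  | succ k ih => exact riccStep_psd A C _ ih _ (hg k)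

/-- reachable pair -/
def RR {ι κ : Type} [Fintype ι] [Fintype κ] [DecidableEq ι] [DecidableEq κ]
    (A : Matrix ι ι ℂ) (C : Matrix κ ι ℂ) (g : ℕ → ℝ) (k : ℕ) (x : ι → ℂ) (s : ℝ) : Prop :=
  ∃ u : ι → ℂ, x = ricc A C 1 1 1 g k *ᵥ u ∧
    s = √ (star u ⬝ᵥ (ricc A C 1 1 1 g k *ᵥ u)).re

lemma self_dot {ι : Type} [Fintype ι] (u : ι → ℂ) :
    (star u ⬝ᵥ u).re = ∑ i, ‖u i‖ ^ 2 := by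
  simp [dotProduct, Complex.sq_norm, Complex.normSq_apply]

lemma norm_le_sqrt {ι : Type} [Fintype ι] (u : ι → ℂ) (i : ι) (J : ℝ)
    (h : (star u ⬝ᵥ u).re ≤ J) : ‖u i‖ ≤ √ J := by
  apply Real.le_sqrt_of_sq_le
  rw [self_dot] at h
  exact (Finset.single_le_sum (f := fun i => ‖u i‖ ^ 2) (fun _ _ => by positivity)
    (Finset.mem_univ i)).trans h

lemma RR_nonneg {ι κ : Type} [Fintype ι] [Fintype κ] [DecidableEq ι] [DecidableEq κ]
    {A : Matrix ι ι ℂ} {C : Matrix κ ι ℂ} {g : ℕ → ℝ} {k : ℕ} {x : ι → ℂ} {s : ℝ}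
    (h : RR A C g k x s) : 0 ≤ s := by
  obtain ⟨u, -, rfl⟩ := h
  exact Real.sqrt_nonneg _

lemma RR_zero {ι κ : Type} [Fintype ι] [Fintype κ] [DecidableEq ι] [DecidableEq κ]
    {A : Matrix ι ι ℂ} {C : Matrix κ ι ℂ} {g : ℕ → ℝ} {x : ι → ℂ} {s : ℝ}
    (h : RR A C g 0 x s) (i : ι) : ‖x i‖ ≤ s := by
  obtain ⟨u, rfl, rfl⟩ := h
  simp only [ricc, Matrix.one_mulVec]
  exact norm_le_sqrt _ _ _ le_rfl

lemma RR_succ {ι κ : Type} [Fintype ι] [Fintype κ] [DecidableEq ι] [DecidableEq κ]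
    {A : Matrix ι ι ℂ} {C : Matrix κ ι ℂ} {g : ℕ → ℝ} (hg : ∀ k, g k = 0 ∨ g k = 1)
    {k : ℕ} {x : ι → ℂ} {s : ℝ}
    (h : RR A C g (k + 1) x s) : ∃ x' s', RR A C g k x' s' ∧ s' ≤ s ∧
      (∀ i, ‖x i - (A *ᵥ x') i‖ ≤ s) ∧ (g k = 1 → ∀ i, ‖(C *ᵥ x') i‖ ≤ s) := by
  obtain ⟨u, rfl, rfl⟩ := h
  have hP := ricc_psd A C g hg k
  have hSu := (Matrix.isUnit_iff_isUnit_det _).1 (psd_S C _ hP).isUnit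
  obtain ⟨u', h1, h2⟩ := riccStep_decomp A C _ hSu (g k) (hg k) u
  have e : ricc A C 1 1 1 g (k + 1) = riccStep A C 1 1 (g k) (ricc A C 1 1 1 g k) := rfl
  rw [e, h2, h1]
  set P := ricc A C 1 1 1 g k
  have n1 : 0 ≤ (star u' ⬝ᵥ (P *ᵥ u')).re := (Complex.le_def.1 (hP.dotProduct_mulVec_nonneg u')).1
  have n2 : 0 ≤ (star (C *ᵥ (P *ᵥ u')) ⬝ᵥ (C *ᵥ (P *ᵥ u'))).re := by
    rw [self_dot]; positivity
  have n3 : 0 ≤ (star u ⬝ᵥ u).re := by rw [self_dot]; positivity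
  have n4 : 0 ≤ g k * (star (C *ᵥ (P *ᵥ u')) ⬝ᵥ (C *ᵥ (P *ᵥ u'))).re := by
    rcases hg k with h | h <;> rw [h] <;> linarith
  refine ⟨P *ᵥ u', _, ⟨u', rfl, rfl⟩, ?_, ?_, ?_⟩
  · apply Real.sqrt_le_sqrt
    simp only [Complex.add_re, Complex.re_ofReal_mul]
    linarith
  · intro i
    simp only [Pi.add_apply, add_sub_cancel_left]
    apply norm_le_sqrt
    simp only [Complex.add_re, Complex.re_ofReal_mul]
    linarith
  · intro hk i
    apply norm_le_sqrt
    simp only [Complex.add_re, Complex.re_ofReal_mul]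
    rw [hk] at n4 ⊢
    linarith

/-- the partial information bound -/
def BB {ι κ : Type} [Fintype ι] [Fintype κ] [DecidableEq ι] [DecidableEq κ]
    (A : Matrix ι ι ℂ) (C : Matrix κ ι ℂ) (g : ℕ → ℝ) (S : Finset ι) (k : ℕ) (a b : ℝ) : Prop :=
  ∀ x s, RR A C g k x s → ∀ h : ℝ, 0 ≤ h → (∀ j, j ∉ S → ‖x j‖ ≤ h) →
    ∀ i ∈ S, ‖x i‖ ≤ a * s + b * h

lemma BB_mono {ι κ : Type} [Fintype ι] [Fintype κ] [DecidableEq ι] [DecidableEq κ]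
    {A : Matrix ι ι ℂ} {C : Matrix κ ι ℂ} {g : ℕ → ℝ} {S : Finset ι} {k : ℕ} {a b a' b' : ℝ}
    (h : BB A C g S k a b) (ha : a ≤ a') (hb : b ≤ b') : BB A C g S k a' b' := by
  intro x s hR t ht hj i hi
  have := RR_nonneg hR
  refine (h x s hR t ht hj i hi).trans ?_
  gcongr

lemma BB_zero {ι κ : Type} [Fintype ι] [Fintype κ] [DecidableEq ι] [DecidableEq κ]
    {A : Matrix ι ι ℂ} {C : Matrix κ ι ℂ} {g : ℕ → ℝ} {S : Finset ι} :
    BB A C g S 0 1 0 := by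
  intro x s hR t ht hj i hi
  simpa using RR_zero hR i

lemma back_bound {z w d : ℂ} {s h r : ℝ} (hr : 0 < r) (hd : r ≤ ‖d‖) (hz : ‖z‖ ≤ h)
    (hw : ‖z - d * w‖ ≤ s) : ‖w‖ ≤ (h + s) / r := by
  have : ‖d‖ * ‖w‖ ≤ h + s := by
    rw [← norm_mul]
    calc ‖d * w‖ = ‖z - (z - d * w)‖ := by ring_nf
      _ ≤ ‖z‖ + ‖z - d * w‖ := norm_sub_le _ _
      _ ≤ _ := add_le_add hz hw
  rw [le_div_iff₀ hr]
  nlinarith [norm_nonneg w]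

lemma fwd_bound {z w d : ℂ} {s r : ℝ} (hd : ‖d‖ ≤ r)
    (hw : ‖z - d * w‖ ≤ s) : ‖z‖ ≤ r * ‖w‖ + s := by
  calc ‖z‖ = ‖d * w + (z - d * w)‖ := by ring_nf
    _ ≤ ‖d * w‖ + ‖z - d * w‖ := norm_add_le _ _
    _ ≤ r * ‖w‖ + s := by rw [norm_mul]; gcongr

lemma BB_coast {ι κ : Type} [Fintype ι] [Fintype κ] [DecidableEq ι] [DecidableEq κ]
    {d : ι → ℂ} {C : Matrix κ ι ℂ} {g : ℕ → ℝ} (hg : ∀ k, g k = 0 ∨ g k = 1)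
    {S : Finset ι} {k : ℕ} {a b rl rh r1 : ℝ} (ha : 0 ≤ a) (hb : 0 ≤ b) (hrl : 0 < rl)
    (hlh : rl < rh) (hl1 : rl ≤ r1) (hS : ∀ i ∈ S, ‖d i‖ ≤ rl) (hS' : ∀ i, i ∉ S → rh ≤ ‖d i‖)
    (h : BB (diagonal d) C g S k a b) :
    BB (diagonal d) C g S (k + 1) (r1 * a + b + 1) (rl / rh * b) := by
  intro x s hR t ht hj i hi
  have hs := RR_nonneg hR
  obtain ⟨x', s', hR', hss, h1, -⟩ := RR_succ hg hR
  have hs' := RR_nonneg hR'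
  simp only [mulVec_diagonal] at h1
  have hrh : 0 < rh := hrl.trans hlh
  have h2 := h x' s' hR' ((t + s) / rh) (by positivity)
    (fun j hjS => back_bound hrh (hS' j hjS) (hj j hjS) (h1 j)) i hi
  have h3 := fwd_bound (hS i hi) (h1 i)
  have e1 : rl / rh ≤ 1 := by rw [div_le_one hrh]; exact hlh.le
  have e2 : rl * (a * s') ≤ r1 * a * s := by
    rw [mul_assoc]
    have : 0 ≤ r1 := hrl.le.trans hl1
    gcongr
  have e3 : rl * (b * ((t + s) / rh)) = rl / rh * b * t + rl / rh * (b * s) := by ring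
  have e4 : rl / rh * (b * s) ≤ 1 * (b * s) := by gcongr
  calc ‖x i‖ ≤ rl * ‖x' i‖ + s := h3
    _ ≤ rl * (a * s' + b * ((t + s) / rh)) + s := by gcongr
    _ ≤ _ := by rw [mul_add, e3]; linarith

lemma BB_coast_n {ι κ : Type} [Fintype ι] [Fintype κ] [DecidableEq ι] [DecidableEq κ]
    {d : ι → ℂ} {C : Matrix κ ι ℂ} {g : ℕ → ℝ} (hg : ∀ k, g k = 0 ∨ g k = 1)
    {S : Finset ι} {k : ℕ} {a b rl rh r1 E : ℝ} (ha : 0 ≤ a) (hb : 0 ≤ b) (hrl : 0 < rl)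
    (hlh : rl < rh) (hl1 : rl ≤ r1) (h1 : 1 < r1) (hE : 0 ≤ E) (hEb : b + 1 ≤ E * (r1 - 1))
    (hS : ∀ i ∈ S, ‖d i‖ ≤ rl) (hS' : ∀ i, i ∉ S → rh ≤ ‖d i‖)
    (h : BB (diagonal d) C g S k a b) (t : ℕ) :
    BB (diagonal d) C g S (k + t) (r1 ^ t * (a + E) - E) ((rl / rh) ^ t * b) := by
  have hrh : 0 < rh := hrl.trans hlh
  have e1 : rl / rh ≤ 1 := by rw [div_le_one hrh]; exact hlh.le
  induction t with
  | zero => simpa using h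
  | succ t ih =>
    have h0 : 0 ≤ r1 ^ t * (a + E) - E := by
      have : 1 * (a + E) ≤ r1 ^ t * (a + E) := by
        gcongr; exact one_le_pow₀ h1.le
      linarith
    have h2 := BB_coast hg h0 (by positivity) hrl hlh hl1 hS hS' ih
    have h3 : (rl / rh) ^ t * b ≤ 1 * b := by
      gcongr; exact pow_le_one₀ (by positivity) e1
    refine BB_mono h2 ?_ (le_of_eq (by ring))
    rw [pow_succ]
    nlinarith

lemma BB_packet {ι κ : Type} [Fintype ι] [Fintype κ] [DecidableEq ι] [DecidableEq κ]
    {d : ι → ℂ} {C : Matrix κ ι ℂ} {g : ℕ → ℝ} (hg : ∀ k, g k = 0 ∨ g k = 1)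
    {S0 G : Finset ι} {k : ℕ} {a ε r1 κ' c : ℝ} (ha : 0 ≤ a) (hε : 0 ≤ ε) (hε1 : ε ≤ 1)
    (hκ : 0 < κ') (hc : 0 ≤ c) (hsm : κ' * c * ε ≤ 1 / 2)
    (hr1 : ∀ i, ‖d i‖ ≤ r1) (hd1 : ∀ i, 1 ≤ ‖d i‖)
    (hC : ∀ i, ∑ j, ‖C i j‖ ≤ c)
    (hG : ∀ (x : ι → ℂ) (e : ℝ), (∀ i, ‖∑ j ∈ G, C i j * x j‖ ≤ e) → 0 ≤ e →
      ∀ j ∈ G, ‖x j‖ ≤ κ' * e)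
    (h : BB (diagonal d) C g S0 k a ε) (hk : g k = 1) :
    BB (diagonal d) C g (S0 ∪ G) (k + 1)
      (r1 * ((1 + 2 * κ' * c) * a + 2 * κ' + 1 + 4 * κ' * c) + 1) (r1 * (1 + 4 * κ' * c)) := by
  intro x s hR t ht hj i hi
  have hs := RR_nonneg hR
  obtain ⟨x', s', hR', hss, h1, h2⟩ := RR_succ hg hR
  have hs' := RR_nonneg hR'
  simp only [mulVec_diagonal] at h1
  replace h2 := h2 hk
  have hout : ∀ j, j ∉ S0 ∪ G → ‖x' j‖ ≤ t + s := fun j hjS => by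
    simpa using back_bound one_pos (hd1 j) (hj j hjS) (h1 j)
  obtain ⟨H, hH0, hHG, hHm⟩ : ∃ H : ℝ, 0 ≤ H ∧ (∀ j ∈ G, ‖x' j‖ ≤ H) ∧
      (H = 0 ∨ ∃ j ∈ G, H = ‖x' j‖) := by
    by_cases hne : G.Nonempty
    · obtain ⟨j, hjG, hm⟩ := G.exists_max_image (fun j => ‖x' j‖) hne
      exact ⟨‖x' j‖, norm_nonneg _, hm, Or.inr ⟨j, hjG, rfl⟩⟩
    · rw [Finset.not_nonempty_iff_eq_empty] at hne
      exact ⟨0, le_rfl, by simp [hne], Or.inl rfl⟩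
  have hlo : ∀ i ∈ S0, ‖x' i‖ ≤ a * s + ε * (t + s + H) := by
    intro i hi
    refine (h x' s' hR' (t + s + H) (by positivity) ?_ i hi).trans (by gcongr)
    intro j hjS
    by_cases hjG : j ∈ G
    · linarith [hHG j hjG]
    · have := hout j (by simp [hjS, hjG]); linarith
  set m := a * s + ε * (t + s + H) + (t + s) with hm
  have hm0 : 0 ≤ m := by positivity
  have hnotG : ∀ j, j ∉ G → ‖x' j‖ ≤ m := by
    intro j hjG
    by_cases hjS : j ∈ S0
    · have := hlo j hjS; linarith
    · have := hout j (by simp [hjS, hjG])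
      have : 0 ≤ a * s + ε * (t + s + H) := by positivity
      linarith
  have hsum : ∀ l, ‖∑ j ∈ G, C l j * x' j‖ ≤ s + c * m := by
    intro l
    have e : ∑ j ∈ G, C l j * x' j = (C *ᵥ x') l - ∑ j ∈ Gᶜ, C l j * x' j := by
      rw [Matrix.mulVec, dotProduct, ← Finset.sum_add_sum_compl G]; ring
    rw [e]
    refine (norm_sub_le _ _).trans (add_le_add (h2 l) ?_)
    calc ‖∑ j ∈ Gᶜ, C l j * x' j‖ ≤ ∑ j ∈ Gᶜ, ‖C l j‖ * m := by
          refine (norm_sum_le _ _).trans (Finset.sum_le_sum fun j hj => ?_)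
          rw [norm_mul]
          exact mul_le_mul_of_nonneg_left (hnotG j (by simpa using hj)) (norm_nonneg _)
      _ ≤ ∑ j, ‖C l j‖ * m := Finset.sum_le_sum_of_subset_of_nonneg (Finset.subset_univ _)
          (fun _ _ _ => by positivity)
      _ ≤ c * m := by rw [← Finset.sum_mul]; gcongr; exact hC l
  have hHb : H ≤ κ' * (s + c * m) := by
    rcases hHm with h0 | ⟨j, hjG, hj⟩
    · rw [h0]; positivity
    · rw [hj]; exact hG x' _ hsum (by positivity) j hjG
  have hH2 : H ≤ 2 * κ' * (s + c * (a * s) + 2 * c * (t + s)) := by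
    have e1 : κ' * c * ε * H ≤ 1 / 2 * H := by gcongr
    have e2 : κ' * c * (ε * (t + s)) ≤ κ' * c * (1 * (t + s)) := by gcongr
    rw [hm] at hHb
    nlinarith
  have hall : ‖x' i‖ ≤ a * s + (t + s) + H := by
    rcases Finset.mem_union.1 hi with hi | hi
    · have := hlo i hi
      have e2 : (ε * (t + s + H)) ≤ (1 * (t + s + H)) := by gcongr
      linarith
    · have := hHG i hi
      have : 0 ≤ a * s := by positivity
      linarith
  have hr0 : 0 ≤ r1 := by linarith [hr1 i, hd1 i]
  calc ‖x i‖ ≤ r1 * ‖x' i‖ + s := fwd_bound (hr1 i) (h1 i)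
    _ ≤ r1 * (a * s + (t + s) + 2 * κ' * (s + c * (a * s) + 2 * c * (t + s))) + s := by
        gcongr; linarith
    _ = _ := by ring

end Aux

section Prob

set_option linter.unusedSectionVars false

variable {Ω : Type} [MeasurableSpace Ω]

/-- past sigma algebra -/
@[reducible] def mF (γ : ℕ → Ω → ℝ) (k : ℕ) : MeasurableSpace Ω :=
  ⨆ i ∈ Set.Iio k, MeasurableSpace.comap (γ i) inferInstance

lemma mF_le {γ : ℕ → Ω → ℝ} (hmeas : ∀ k, Measurable (γ k)) (k : ℕ) :
    mF γ k ≤ (inferInstance : MeasurableSpace Ω) :=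
  iSup₂_le fun i _ => (hmeas i).comap_le

lemma mF_mono (γ : ℕ → Ω → ℝ) {k l : ℕ} (h : k ≤ l) : mF γ k ≤ mF γ l :=
  biSup_mono fun _ hi => lt_of_lt_of_le hi h

lemma mF_set (γ : ℕ → Ω → ℝ) (k : ℕ) : MeasurableSet[mF γ (k + 1)] {ω | γ k ω = 1} := by
  have h : MeasurableSpace.comap (γ k) inferInstance ≤ mF γ (k + 1) :=
    le_iSup₂_of_le (f := fun i (_ : i ∈ Set.Iio (k + 1)) =>
      MeasurableSpace.comap (γ i) inferInstance) k (Nat.lt_succ_self k) le_rfl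
  exact h _ ⟨{1}, measurableSet_singleton _, rfl⟩

lemma lint_indep {μ : Measure Ω} [IsProbabilityMeasure μ] {γ : ℕ → Ω → ℝ} {p : ℝ}
    (hp0 : 0 ≤ p)
    (hmeas : ∀ k, Measurable (γ k)) (hind : iIndepFun γ μ)
    (hber : ∀ k, μ {ω | γ k ω = 1} = ENNReal.ofReal p) (k : ℕ) (f : Ω → ℝ≥0∞)
    (hf : Measurable[mF γ k] f) :
    ∫⁻ ω, f ω * {ω | γ k ω = 1}ᶜ.indicator 1 ω ∂μ = (∫⁻ ω, f ω ∂μ) * ENNReal.ofReal (1 - p) := by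
  have hI : Indep (mF γ k) (⨆ i ∈ ({k} : Set ℕ), MeasurableSpace.comap (γ i) inferInstance) μ :=
    indep_iSup_of_disjoint (fun i => (hmeas i).comap_le) hind.iIndep (by simp)
  have hs : MeasurableSet {ω | γ k ω = 1} := hmeas k (measurableSet_singleton 1)
  rw [lintegral_mul_eq_lintegral_mul_lintegral_of_independent_measurableSpace (mF_le hmeas k)
    (iSup₂_le fun i _ => (hmeas i).comap_le) hI hf]
  · congr 1
    rw [lintegral_indicator_one hs.compl, prob_compl_eq_one_sub hs, hber,
      ENNReal.ofReal_sub _ hp0, ENNReal.ofReal_one]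
  · have hle : MeasurableSpace.comap (γ k) inferInstance ≤
        ⨆ i ∈ ({k} : Set ℕ), MeasurableSpace.comap (γ i) inferInstance :=
      le_iSup₂_of_le (f := fun i (_ : i ∈ ({k} : Set ℕ)) =>
        MeasurableSpace.comap (γ i) inferInstance) k rfl le_rfl
    have hms := hle _ (⟨{1}ᶜ, (measurableSet_singleton _).compl, rfl⟩ :
      MeasurableSet[MeasurableSpace.comap (γ k) inferInstance] {ω | γ k ω = 1}ᶜ)
    exact Measurable.indicator (f := fun _ => (1 : ℝ≥0∞)) measurable_const hms

/-- the dominating scalar process -/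
noncomputable def ZZ (γ : ℕ → Ω → ℝ) (Z0 : ℕ → Ω → ℝ) (L r1 z0 : ℝ) (T : ℕ) : ℕ → Ω → ℝ
  | 0 => fun _ => z0
  | k + 1 => fun ω => open Classical in
      if γ k ω = 1 then L * Z0 (k - T) ω else r1 * ZZ γ Z0 L r1 z0 T k ω

lemma ZZ_meas {γ : ℕ → Ω → ℝ} {Z0 : ℕ → Ω → ℝ} {L r1 z0 : ℝ} {T : ℕ}
    (h0 : ∀ k, Measurable[mF γ k] (Z0 k)) (k : ℕ) :
    Measurable[mF γ k] (ZZ γ Z0 L r1 z0 T k) := by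
  induction k with
  | zero => exact measurable_const
  | succ k ih =>
    have h1 : Measurable[mF γ (k + 1)] (Z0 (k - T)) :=
      (h0 _).mono (mF_mono γ (by omega)) le_rfl
    have h2 : Measurable[mF γ (k + 1)] (ZZ γ Z0 L r1 z0 T k) :=
      ih.mono (mF_mono γ (by omega)) le_rfl
    unfold ZZ
    exact Measurable.ite (mF_set γ k) (h1.const_mul L) (h2.const_mul r1)

lemma ZZ_one {γ : ℕ → Ω → ℝ} {Z0 : ℕ → Ω → ℝ} {L r1 z0 : ℝ} {T : ℕ} (hL : 1 ≤ L) (hr : 1 ≤ r1)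
    (hz : 1 ≤ z0) (h0 : ∀ k ω, 1 ≤ Z0 k ω) (k : ℕ) (ω : Ω) : 1 ≤ ZZ γ Z0 L r1 z0 T k ω := by
  induction k with
  | zero => exact hz
  | succ k ih =>
    unfold ZZ
    split_ifs
    · nlinarith [h0 (k - T) ω]
    · nlinarith

lemma ZZ_mom {μ : Measure Ω} [IsProbabilityMeasure μ] {γ : ℕ → Ω → ℝ} {p : ℝ}
    (hp : p ∈ Set.Ioc (0 : ℝ) 1)
    (hmeas : ∀ k, Measurable (γ k)) (hind : iIndepFun γ μ)
    (hber : ∀ k, μ {ω | γ k ω = 1} = ENNReal.ofReal p) {N : ℕ}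
    {Z0 : ℕ → Ω → ℝ} {L r1 z0 : ℝ} {T : ℕ} (hL : 1 ≤ L) (hr : 1 ≤ r1)
    (hz : 1 ≤ z0) (hβ : (1 - p) * r1 ^ N < 1)
    (h0 : ∀ k, Measurable[mF γ k] (Z0 k)) 
    {M0 : ℝ} (hM0 : 0 ≤ M0) (hM : ∀ k, ∫⁻ ω, ENNReal.ofReal (Z0 k ω ^ N) ∂μ ≤ ENNReal.ofReal M0) :
    ∃ M : ℝ, 0 ≤ M ∧
      ∀ k, ∫⁻ ω, ENNReal.ofReal (ZZ γ Z0 L r1 z0 T k ω ^ N) ∂μ ≤ ENNReal.ofReal M := by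
  set β := (1 - p) * r1 ^ N with hβd
  have hp1 : 0 ≤ 1 - p := by linarith [hp.2]
  have hβ0 : 0 ≤ β := mul_nonneg hp1 (by positivity)
  have h1β : 0 < 1 - β := by linarith
  set M' := L ^ N * M0 with hM'
  have hM'0 : 0 ≤ M' := by positivity
  refine ⟨z0 ^ N + M' / (1 - β), by positivity, fun k => ?_⟩
  induction k with
  | zero =>
    simp only [ZZ, lintegral_const, measure_univ, mul_one]
    apply ENNReal.ofReal_le_ofReal
    have : 0 ≤ M' / (1 - β) := by positivity
    linarith
  | succ k ih =>
    have hZm := ZZ_meas (γ := γ) (L := L) (r1 := r1) (z0 := z0) (T := T) h0 k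
    have hfm : Measurable[mF γ k] (fun ω => ENNReal.ofReal (ZZ γ Z0 L r1 z0 T k ω ^ N)) :=
      ENNReal.measurable_ofReal.comp (hZm.pow_const N)
    have hfm' : Measurable (fun ω => ENNReal.ofReal (ZZ γ Z0 L r1 z0 T k ω ^ N)) :=
      hfm.mono (mF_le hmeas k) le_rfl
    have hs : MeasurableSet {ω | γ k ω = 1} := hmeas k (measurableSet_singleton 1)
    have hi : Measurable ({ω | γ k ω = 1}ᶜ.indicator (1 : Ω → ℝ≥0∞)) :=
      measurable_one.indicator hs.compl
    have hpt : ∀ ω, ENNReal.ofReal (ZZ γ Z0 L r1 z0 T (k + 1) ω ^ N) ≤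
        ENNReal.ofReal (r1 ^ N) * (ENNReal.ofReal (ZZ γ Z0 L r1 z0 T k ω ^ N) *
          {ω | γ k ω = 1}ᶜ.indicator 1 ω) +
        ENNReal.ofReal (L ^ N) * ENNReal.ofReal (Z0 (k - T) ω ^ N) := by
      intro ω
      by_cases hω : γ k ω = 1
      · refine le_trans ?_ le_add_self
        rw [ZZ]; simp only [hω, if_true]
        rw [mul_pow, ENNReal.ofReal_mul (by positivity)]
      · refine le_trans ?_ le_self_add
        rw [ZZ]; simp only [hω, if_false]
        rw [mul_pow, ENNReal.ofReal_mul (by positivity)]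
        simp [Set.indicator, hω]
    calc ∫⁻ ω, ENNReal.ofReal (ZZ γ Z0 L r1 z0 T (k + 1) ω ^ N) ∂μ
        ≤ _ := lintegral_mono hpt
      _ = ENNReal.ofReal (r1 ^ N) * ((∫⁻ ω, ENNReal.ofReal (ZZ γ Z0 L r1 z0 T k ω ^ N) ∂μ) *
          ENNReal.ofReal (1 - p)) +
          ENNReal.ofReal (L ^ N) * ∫⁻ ω, ENNReal.ofReal (Z0 (k - T) ω ^ N) ∂μ := by
        have hmi : Measurable (fun ω => ENNReal.ofReal (ZZ γ Z0 L r1 z0 T k ω ^ N) *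
          {ω | γ k ω = 1}ᶜ.indicator (1 : Ω → ℝ≥0∞) ω) := hfm'.mul hi
        rw [lintegral_add_left (hmi.const_mul _), lintegral_const_mul _ hmi,
          lintegral_const_mul' _ _ ENNReal.ofReal_ne_top, lint_indep hp.1.le hmeas hind hber k _ hfm]
      _ ≤ ENNReal.ofReal (r1 ^ N) * (ENNReal.ofReal (z0 ^ N + M' / (1 - β)) *
          ENNReal.ofReal (1 - p)) + ENNReal.ofReal (L ^ N) * ENNReal.ofReal M0 := by
        gcongr
        exact hM _
      _ = ENNReal.ofReal (β * (z0 ^ N + M' / (1 - β)) + M') := by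
        rw [← ENNReal.ofReal_mul (by positivity), ← ENNReal.ofReal_mul (by positivity),
          ← ENNReal.ofReal_mul (by positivity), ← ENNReal.ofReal_add (by positivity) (by positivity)]
        congr 1; rw [hβd]; ring
      _ ≤ _ := by
        apply ENNReal.ofReal_le_ofReal
        have e : M' / (1 - β) * (1 - β) = M' := div_mul_cancel₀ _ h1β.ne'
        have : β * z0 ^ N ≤ 1 * z0 ^ N := by gcongr
        nlinarith

/-- the inductive statement -/
def GG {ι κ : Type} [Fintype ι] [Fintype κ] [DecidableEq ι] [DecidableEq κ]
    (d : ι → ℂ) (C : Matrix κ ι ℂ) (μ : Measure Ω) (γ : ℕ → Ω → ℝ) (N : ℕ) (S : Finset ι) : Prop :=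
  ∃ (Z : ℕ → Ω → ℝ) (D M : ℝ), 0 ≤ D ∧ 0 ≤ M ∧ (∀ k, Measurable[mF γ k] (Z k)) ∧
    (∀ k ω, 1 ≤ Z k ω) ∧ (∀ k, ∫⁻ ω, ENNReal.ofReal (Z k ω ^ N) ∂μ ≤ ENNReal.ofReal M) ∧
    (∀ ω k, BB (diagonal d) C (fun i => γ i ω) S k (Z k ω) D) ∧
    (∀ ω, BB (diagonal d) C (fun i => γ i ω) S 0 (Z 0 ω) 0)

lemma GG_empty {ι κ : Type} [Fintype ι] [Fintype κ] [DecidableEq ι] [DecidableEq κ]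
    (d : ι → ℂ) (C : Matrix κ ι ℂ) (μ : Measure Ω) [IsProbabilityMeasure μ]
    (γ : ℕ → Ω → ℝ) (N : ℕ) : GG d C μ γ N ∅ := by
  refine ⟨fun _ _ => 1, 0, 1, le_rfl, zero_le_one, fun k => measurable_const, fun _ _ => le_rfl,
    fun k => by simp, ?_, ?_⟩
  · intro ω k x s hR h hh hj i hi; simp at hi
  · intro ω x s hR h hh hj i hi; simp at hi

lemma nondeg_const {ι κ : Type} [Fintype ι] [Fintype κ] [DecidableEq ι]
    {d : ι → ℂ} {C : Matrix κ ι ℂ} (hnd : NonDeg d C) (r : ℝ) :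
    ∃ κ' : ℝ, 0 < κ' ∧ ∀ (x : ι → ℂ) (e : ℝ), 
      (∀ i, ‖∑ j ∈ Finset.univ.filter (fun j => ‖d j‖ = r), C i j * x j‖ ≤ e) → 0 ≤ e →
      ∀ j ∈ Finset.univ.filter (fun j => ‖d j‖ = r), ‖x j‖ ≤ κ' * e := by
  classical
  have hli := hnd r
  set v := (fun j : {j : ι // ‖d j‖ = r} => fun i : κ => C i j.1) with hv
  have hker : LinearMap.ker (Fintype.linearCombination ℂ v) = ⊥ :=
    LinearMap.ker_eq_bot.2 (linearIndependent_iff_injective_fintypeLinearCombination.1 hli)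
  obtain ⟨K, hK, hA⟩ := LinearMap.exists_antilipschitzWith _ hker
  refine ⟨K, by exact_mod_cast hK, fun x e he he0 j hj => ?_⟩
  have hj' : ‖d j‖ = r := by simpa using hj
  have h1 := hA.le_mul_dist (fun j => x j.1) 0
  rw [map_zero, dist_zero_right, dist_zero_right] at h1
  have h2 : ‖x j‖ ≤ ‖(fun j : {j : ι // ‖d j‖ = r} => x j.1)‖ :=
    norm_le_pi_norm (fun j : {j : ι // ‖d j‖ = r} => x j.1) ⟨j, hj'⟩
  refine (h2.trans h1).trans ?_
  gcongr
  rw [pi_norm_le_iff_of_nonneg he0]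
  intro i
  refine le_trans (le_of_eq ?_) (he i)
  congr 1
  rw [Fintype.linearCombination_apply, Finset.sum_apply]
  rw [← Finset.sum_subtype_eq_sum_filter, Finset.subtype_univ]
  simp [hv, mul_comm]

set_option maxHeartbeats 1600000 in
lemma GG_step {ι κ : Type} [Fintype ι] [Fintype κ] [DecidableEq ι] [DecidableEq κ]
    {d : ι → ℂ} {C : Matrix κ ι ℂ} (hnd : NonDeg d C) {r1 : ℝ} (hr1 : ∀ i, ‖d i‖ ≤ r1)
    (hd1 : ∀ i, 1 ≤ ‖d i‖) (h1 : 1 < r1)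
    {μ : Measure Ω} [IsProbabilityMeasure μ] {γ : ℕ → Ω → ℝ} {p : ℝ}
    (hp : p ∈ Set.Ioc (0 : ℝ) 1)
    (hmeas : ∀ k, Measurable (γ k)) (hind : iIndepFun γ μ)
    (h01 : ∀ k ω, γ k ω = 0 ∨ γ k ω = 1)
    (hber : ∀ k, μ {ω | γ k ω = 1} = ENNReal.ofReal p) {N : ℕ}
    (hβ : (1 - p) * r1 ^ N < 1) {S0 G : Finset ι} {rl r rh : ℝ} (hrl : 0 < rl) (hlr : rl < r)
    (hrr : r ≤ r1) (hrh : r < rh) (hS0 : ∀ i ∈ S0, ‖d i‖ ≤ rl) (hS0' : ∀ i, i ∉ S0 → r ≤ ‖d i‖)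
    (hS : ∀ i ∈ S0 ∪ G, ‖d i‖ ≤ r) (hS' : ∀ i, i ∉ S0 ∪ G → rh ≤ ‖d i‖)
    (hG : G = Finset.univ.filter (fun j => ‖d j‖ = r))
    (hGG : GG d C μ γ N S0) : GG d C μ γ N (S0 ∪ G) := by
  obtain ⟨Z0, D0, M0, hD0, hM0, hZm, hZ1, hZM, hB, hB0⟩ := hGG
  obtain ⟨κ', hκ, hK⟩ := nondeg_const hnd r
  rw [← hG] at hK
  set c : ℝ := ∑ i, ∑ j, ‖C i j‖ with hcd
  have hc : 0 ≤ c := by positivity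
  have hC : ∀ i, ∑ j, ‖C i j‖ ≤ c := fun i =>
    Finset.single_le_sum (f := fun i => ∑ j, ‖C i j‖) (fun _ _ => by positivity) (Finset.mem_univ i)
  set ε : ℝ := 1 / (1 + 2 * κ' * c) with hεd
  have hden : 0 < 1 + 2 * κ' * c := by positivity
  have hε : 0 < ε := by positivity
  have hε1 : ε ≤ 1 := by
    rw [hεd, div_le_one hden]
    have : 0 ≤ 2 * κ' * c := by positivity
    linarith
  have hsm : κ' * c * ε ≤ 1 / 2 := by
    rw [hεd, mul_one_div, div_le_div_iff₀ hden two_pos]; linarith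
  have hr0 : 0 < r := hrl.trans hlr
  have hθ : rl / r < 1 := by rwa [div_lt_one hr0]
  obtain ⟨T, hT⟩ := exists_pow_lt_of_lt_one (show 0 < ε / (D0 + 1) by positivity) hθ
  have hT' : (rl / r) ^ T * D0 ≤ ε := by
    rw [lt_div_iff₀ (by positivity)] at hT
    have : 0 ≤ (rl / r) ^ T := by positivity
    linarith
  have hr11 : 0 < r1 - 1 := by linarith
  set E0 : ℝ := (D0 + 1) / (r1 - 1) with hE0
  have hE0p : 0 ≤ E0 := by positivity
  have hE0e : E0 * (r1 - 1) = D0 + 1 := div_mul_cancel₀ _ hr11.ne'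
  have hpre : ∀ ω k, BB (diagonal d) C (fun i => γ i ω) S0 k (r1 ^ T * (Z0 (k - T) ω + E0)) ε := by
    intro ω k
    have hz := hZ1 (k - T) ω
    rcases le_total T k with hk | hk
    · have := BB_coast_n (fun k => h01 k ω) (by linarith) hD0 hrl hlr (hlr.le.trans hrr) h1 hE0p
        hE0e.ge hS0 hS0' (hB ω (k - T)) T
      rw [Nat.sub_add_cancel hk] at this
      exact BB_mono this (by linarith) hT'
    · have hk0 : k - T = 0 := by omega
      rw [hk0] at hz ⊢
      have := BB_coast_n (fun k => h01 k ω) (by linarith) le_rfl hrl hlr (hlr.le.trans hrr) h1 hE0p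
        (by linarith) hS0 hS0' (hB0 ω) k
      rw [zero_add] at this
      refine BB_mono this ?_ (by simpa using hε.le)
      have : r1 ^ k * (Z0 0 ω + E0) ≤ r1 ^ T * (Z0 0 ω + E0) := by
        have := h1.le
        gcongr
      linarith
  set D : ℝ := r1 * (1 + 4 * κ' * c) with hD
  have hDp : 0 ≤ D := by positivity
  set E : ℝ := (D + 1) / (r1 - 1) with hE
  have hEp : 0 ≤ E := by positivity
  have hEe : E * (r1 - 1) = D + 1 := div_mul_cancel₀ _ hr11.ne'
  set L : ℝ := r1 * ((1 + 2 * κ' * c) * (r1 ^ T * (1 + E0)) + (2 * κ' + 1 + 4 * κ' * c)) + 1 + E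
    with hL
  have hL1 : 1 + E ≤ L := by
    have : 0 ≤ r1 * ((1 + 2 * κ' * c) * (r1 ^ T * (1 + E0)) + (2 * κ' + 1 + 4 * κ' * c)) := by
      positivity
    linarith
  set Z := ZZ γ Z0 L r1 (1 + E) T with hZ
  have hmain : ∀ ω k, 1 + E ≤ Z k ω ∧
      BB (diagonal d) C (fun i => γ i ω) (S0 ∪ G) k (Z k ω - E) D := by
    intro ω k
    induction k with
    | zero =>
      refine ⟨le_rfl, BB_mono BB_zero ?_ hDp⟩
      simp [hZ, ZZ]
    | succ k ih =>
      obtain ⟨ih1, ih2⟩ := ih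
      by_cases hk : γ k ω = 1
      · have hz := hZ1 (k - T) ω
        have eZ : Z (k + 1) ω = L * Z0 (k - T) ω := by simp [hZ, ZZ, hk]
        rw [eZ]
        refine ⟨by nlinarith, ?_⟩
        refine BB_mono (BB_packet (fun k => h01 k ω) (by positivity) hε.le hε1 hκ hc hsm hr1 hd1 hC
          hK (hpre ω k) hk) ?_ le_rfl
        set z := Z0 (k - T) ω
        have e1 : z + E0 ≤ (1 + E0) * z := by nlinarith
        have e2 : r1 * (2 * κ' + 1 + 4 * κ' * c) + 1 + E ≤
            (r1 * (2 * κ' + 1 + 4 * κ' * c) + 1 + E) * z :=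
          le_mul_of_one_le_right (by positivity) hz
        have e3 : r1 * ((1 + 2 * κ' * c) * (r1 ^ T * (z + E0))) ≤
            r1 * ((1 + 2 * κ' * c) * (r1 ^ T * ((1 + E0) * z))) := by gcongr
        rw [hL]
        linarith
      · have eZ : Z (k + 1) ω = r1 * Z k ω := by simp [hZ, ZZ, hk]
        rw [eZ]
        refine ⟨by nlinarith, ?_⟩
        have hq : r / rh ≤ 1 := by
          rw [div_le_one (hr0.trans hrh)]; exact hrh.le
        refine BB_mono (BB_coast (fun k => h01 k ω) (by linarith) hDp hr0 hrh hrr hS hS' ih2) ?_ ?_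
        · linarith
        · nlinarith
  obtain ⟨M, hM, hMM⟩ := ZZ_mom (T := T) hp hmeas hind hber (le_trans (by linarith) hL1) h1.le
    (show 1 ≤ 1 + E by linarith) hβ hZm hM0 hZM
  refine ⟨Z, D, M, hDp, hM, ZZ_meas hZm, fun k ω => by linarith [(hmain ω k).1], hMM,
    fun ω k => BB_mono (hmain ω k).2 (by linarith) le_rfl, fun ω => BB_mono BB_zero ?_ le_rfl⟩
  linarith [(hmain ω 0).1]

lemma GG_all {ι κ : Type} [Fintype ι] [Fintype κ] [DecidableEq ι] [DecidableEq κ]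
    {d : ι → ℂ} {C : Matrix κ ι ℂ} (hnd : NonDeg d C) {r1 : ℝ} (hr1 : ∀ i, ‖d i‖ ≤ r1)
    (hd1 : ∀ i, 1 ≤ ‖d i‖) (h1 : 1 < r1)
    {μ : Measure Ω} [IsProbabilityMeasure μ] {γ : ℕ → Ω → ℝ} {p : ℝ}
    (hp : p ∈ Set.Ioc (0 : ℝ) 1)
    (hmeas : ∀ k, Measurable (γ k)) (hind : iIndepFun γ μ)
    (h01 : ∀ k ω, γ k ω = 0 ∨ γ k ω = 1)
    (hber : ∀ k, μ {ω | γ k ω = 1} = ENNReal.ofReal p) {N : ℕ}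
    (hβ : (1 - p) * r1 ^ N < 1) : GG d C μ γ N Finset.univ := by
  have key : ∀ m : ℕ, ∀ t : ℝ, (Finset.univ.filter (fun i => ‖d i‖ < t)).card = m →
      GG d C μ γ N (Finset.univ.filter (fun i => ‖d i‖ < t)) := by
    intro m
    induction m using Nat.strong_induction_on with
    | _ m ih =>
      intro t ht
      by_cases hne : (Finset.univ.filter (fun i => ‖d i‖ < t)).Nonempty
      · obtain ⟨i0, hi0, hmax⟩ := Finset.exists_max_image _ (fun i => ‖d i‖) hne
        have hi0t : ‖d i0‖ < t := by simpa using hi0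
        have hmax' : ∀ i, ‖d i‖ < t → ‖d i‖ ≤ ‖d i0‖ := fun i hi => hmax i (by simpa using hi)
        have hS : Finset.univ.filter (fun i => ‖d i‖ < t) =
            Finset.univ.filter (fun i => ‖d i‖ < ‖d i0‖) ∪
              Finset.univ.filter (fun i => ‖d i‖ = ‖d i0‖) := by
          ext i
          simp only [Finset.mem_filter, Finset.mem_univ, true_and, Finset.mem_union]
          constructor
          · intro h; exact (hmax' i h).lt_or_eq
          · rintro (h | h) <;> linarith
        have hlt : (Finset.univ.filter (fun i => ‖d i‖ < ‖d i0‖)).card < m := by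
          rw [← ht]
          apply Finset.card_lt_card
          rw [Finset.ssubset_iff_of_subset]
          · exact ⟨i0, hi0, by simp⟩
          · rw [hS]; exact Finset.subset_union_left
        obtain ⟨rl, hrl0, hrl1, hrl2⟩ : ∃ rl : ℝ, 0 < rl ∧ rl < ‖d i0‖ ∧
            ∀ i ∈ Finset.univ.filter (fun i => ‖d i‖ < ‖d i0‖), ‖d i‖ ≤ rl := by
          have hpos : 0 < ‖d i0‖ := by linarith [hd1 i0]
          by_cases hne' : (Finset.univ.filter (fun i => ‖d i‖ < ‖d i0‖)).Nonempty
          · obtain ⟨j, hj, hjm⟩ := Finset.exists_max_image _ (fun i => ‖d i‖) hne'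
            exact ⟨‖d j‖, by linarith [hd1 j], by simpa using hj, hjm⟩
          · rw [Finset.not_nonempty_iff_eq_empty] at hne'
            exact ⟨‖d i0‖ / 2, by linarith, by linarith, by simp [hne']⟩
        have hprev := ih _ hlt ‖d i0‖ rfl
        have hm1 : ∀ i ∈ Finset.univ.filter (fun i => ‖d i‖ < t), ‖d i‖ ≤ ‖d i0‖ := hmax
        have hm2 : ∀ i, i ∉ Finset.univ.filter (fun i => ‖d i‖ < t) → t ≤ ‖d i‖ := by
          intro i hi; simpa using hi
        rw [hS] at hm1 hm2 ⊢
        exact GG_step hnd hr1 hd1 h1 hp hmeas hind h01 hber hβ hrl0 hrl1 (hr1 i0) hi0t hrl2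
          (fun i hi => by simpa using hi) hm1 hm2 rfl hprev
      · rw [Finset.not_nonempty_iff_eq_empty] at hne
        rw [hne]; exact GG_empty _ _ _ _ _
  have := key _ (r1 + 1) rfl
  have e : Finset.univ.filter (fun i => ‖d i‖ < r1 + 1) = Finset.univ := by
    ext i; simp; linarith [hr1 i]
  rwa [e] at this

end Prob

section Fin

variable {Ω : Type} [MeasurableSpace Ω]

lemma ricc_meas {ι κ : Type} [Fintype ι] [Fintype κ] [DecidableEq ι] [DecidableEq κ]
    (A : Matrix ι ι ℂ) (C : Matrix κ ι ℂ) {γ : ℕ → Ω → ℝ}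
    (h01 : ∀ k ω, γ k ω = 0 ∨ γ k ω = 1) (k : ℕ) (s : Set (Matrix ι ι ℂ)) :
    MeasurableSet[mF γ k] {ω | ricc A C 1 1 1 (fun i => γ i ω) k ∈ s} := by
  induction k generalizing s with
  | zero => simp only [ricc]; exact MeasurableSet.const _
  | succ k ih =>
    have h1 := mF_mono γ (Nat.le_succ k) _ (ih (riccStep A C 1 1 1 ⁻¹' s))
    have h0 := mF_mono γ (Nat.le_succ k) _ (ih (riccStep A C 1 1 0 ⁻¹' s))
    have hs := mF_set γ k
    have e : {ω | ricc A C 1 1 1 (fun i => γ i ω) (k + 1) ∈ s} =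
        ({ω | γ k ω = 1} ∩ {ω | ricc A C 1 1 1 (fun i => γ i ω) k ∈ riccStep A C 1 1 1 ⁻¹' s}) ∪
        ({ω | γ k ω = 1}ᶜ ∩ {ω | ricc A C 1 1 1 (fun i => γ i ω) k ∈ riccStep A C 1 1 0 ⁻¹' s}) := by
      ext ω
      rcases h01 k ω with h | h <;> simp [ricc, h]
    rw [e]
    exact (hs.inter h1).union (hs.compl.inter h0)

lemma ricc_fin {ι κ : Type} [Fintype ι] [Fintype κ] [DecidableEq ι] [DecidableEq κ]
    (A : Matrix ι ι ℂ) (C : Matrix κ ι ℂ) {γ : ℕ → Ω → ℝ}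
    (h01 : ∀ k ω, γ k ω = 0 ∨ γ k ω = 1) (k : ℕ) :
    (Set.range fun ω => ricc A C 1 1 1 (fun i => γ i ω) k).Finite := by
  induction k with
  | zero => exact (Set.finite_singleton 1).subset (by rintro _ ⟨ω, rfl⟩; simp [ricc])
  | succ k ih =>
    refine ((ih.image (riccStep A C 1 1 1)).union (ih.image (riccStep A C 1 1 0))).subset ?_
    rintro _ ⟨ω, rfl⟩
    rcases h01 k ω with h | h
    · right; exact ⟨_, ⟨ω, rfl⟩, by simp [ricc, h]⟩
    · left; exact ⟨_, ⟨ω, rfl⟩, by simp [ricc, h]⟩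

lemma ricc_int {ι κ : Type} [Fintype ι] [Fintype κ] [DecidableEq ι] [DecidableEq κ]
    (A : Matrix ι ι ℂ) (C : Matrix κ ι ℂ) {γ : ℕ → Ω → ℝ} {μ : Measure Ω} [IsProbabilityMeasure μ]
    (hmeas : ∀ k, Measurable (γ k))
    (h01 : ∀ k ω, γ k ω = 0 ∨ γ k ω = 1) (k : ℕ) (F : Matrix ι ι ℂ → ℂ) :
    Integrable (fun ω => F (ricc A C 1 1 1 (fun i => γ i ω) k)) μ := by
  have hm : Measurable (fun ω => F (ricc A C 1 1 1 (fun i => γ i ω) k)) := by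
    intro s _
    exact mF_le hmeas k _ (ricc_meas A C h01 k (F ⁻¹' s))
  obtain ⟨B, hB⟩ := ((ricc_fin A C h01 k).image (fun P => ‖F P‖)).bddAbove
  refine Integrable.of_bound hm.aestronglyMeasurable B (ae_of_all _ fun ω => ?_)
  exact hB ⟨_, ⟨ω, rfl⟩, rfl⟩

lemma pow_entry {ι : Type} [Fintype ι] [DecidableEq ι] (P : Matrix ι ι ℂ) {z : ℝ} (hz : 0 ≤ z)
    (h : ∀ i j, ‖P i j‖ ≤ z) (q : ℕ) (i j : ι) :
    ‖(P ^ q) i j‖ ≤ (Fintype.card ι * z) ^ q := by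
  induction q generalizing i j with
  | zero =>
    simp only [pow_zero, Matrix.one_apply]
    split_ifs <;> simp
  | succ q ih =>
    rw [pow_succ, Matrix.mul_apply]
    calc ‖∑ l, (P ^ q) i l * P l j‖ ≤ ∑ l : ι, (Fintype.card ι * z) ^ q * z := by
          refine (norm_sum_le _ _).trans (Finset.sum_le_sum fun l _ => ?_)
          rw [norm_mul]
          exact mul_le_mul (ih i l) (h l j) (norm_nonneg _) (by positivity)
      _ = _ := by rw [Finset.sum_const, Finset.card_univ, nsmul_eq_mul]; ring

lemma loe_of_entry {ι : Type} [Fintype ι] [DecidableEq ι] (X : Matrix ι ι ℂ) (hX : X.IsHermitian)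
    {B : ℝ} (h : ∀ i j, ‖X i j‖ ≤ B) :
    loe X (((Fintype.card ι * B : ℝ) : ℂ) • (1 : Matrix ι ι ℂ)) := by
  have hM : (((Fintype.card ι * B : ℝ) : ℂ) • (1 : Matrix ι ι ℂ)).IsHermitian := by
    rw [Matrix.IsHermitian, Matrix.conjTranspose_smul, Matrix.conjTranspose_one, RCLike.star_def,
      Complex.conj_ofReal]
  have hD := hM.sub hX
  refine Matrix.PosSemidef.of_dotProduct_mulVec_nonneg hD fun x => ?_
  have him : (star x ⬝ᵥ ((((Fintype.card ι * B : ℝ) : ℂ) • (1 : Matrix ι ι ℂ) - X) *ᵥ x)).im = 0 :=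
    hD.im_star_dotProduct_mulVec_self x
  rw [Complex.le_def]
  refine ⟨?_, him.symm⟩
  have h1 : (star x ⬝ᵥ (X *ᵥ x)).re ≤ ∑ i, ∑ j, ‖x i‖ * (B * ‖x j‖) := by
    refine (Complex.re_le_norm _).trans ?_
    simp only [dotProduct, Matrix.mulVec, Finset.mul_sum]
    refine (norm_sum_le _ _).trans (Finset.sum_le_sum fun i _ => ?_)
    refine (norm_sum_le _ _).trans (Finset.sum_le_sum fun j _ => ?_)
    rw [norm_mul, norm_mul, Pi.star_apply, norm_star]
    gcongr
    exact h i j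
  have h2 : ∑ i, ∑ j, ‖x i‖ * (B * ‖x j‖) = B * (∑ i, ‖x i‖) ^ 2 := by
    rw [sq, Finset.sum_mul_sum, Finset.mul_sum]
    refine Finset.sum_congr rfl fun i _ => ?_
    rw [Finset.mul_sum]
    refine Finset.sum_congr rfl fun j _ => by ring
  have h3 : (∑ i, ‖x i‖) ^ 2 ≤ Fintype.card ι * ∑ i, ‖x i‖ ^ 2 := by
    simpa using sq_sum_le_card_mul_sum_sq (s := Finset.univ) (f := fun i => ‖x i‖)
  rcases isEmpty_or_nonempty ι with he | ⟨⟨i⟩⟩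
  · simp [dotProduct]
  have hB : 0 ≤ B := (norm_nonneg _).trans (h i i)
  have h4 := mul_le_mul_of_nonneg_left h3 hB
  rw [Matrix.sub_mulVec, dotProduct_sub, Matrix.smul_mulVec, Matrix.one_mulVec, dotProduct_smul,
    Complex.sub_re, smul_eq_mul, Complex.re_ofReal_mul, self_dot, Complex.zero_re]
  nlinarith

lemma psd_pow_diag {ι : Type} [Fintype ι] [DecidableEq ι] (P : Matrix ι ι ℂ) (hP : P.PosSemidef)
    (i : ι) (q : ℕ) : ((P i i).re) ^ q ≤ ((P ^ q) i i).re := by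
  set t := (P i i).re with ht
  have ht0 : 0 ≤ t := (Complex.le_def.1 hP.diag_nonneg).1
  have hstep : ∀ q, t * ((P ^ q) i i).re ≤ ((P ^ (q + 1)) i i).re := by
    intro q
    induction q with
    | zero => simp [ht]
    | succ q ih =>
      have h1 := (hP.pow q).conjTranspose_mul_mul_same (P - (t : ℂ) • 1)
      have h2 := (Complex.le_def.1 (h1.diag_nonneg (i := i))).1
      have e : (P - (t : ℂ) • (1 : Matrix ι ι ℂ))ᴴ * P ^ q * (P - (t : ℂ) • 1) =
          P ^ (q + 1 + 1) - ((2 * t : ℝ) : ℂ) • P ^ (q + 1) + ((t ^ 2 : ℝ) : ℂ) • P ^ q := by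
        rw [Matrix.conjTranspose_sub, Matrix.conjTranspose_smul, Matrix.conjTranspose_one,
          hP.isHermitian.eq, RCLike.star_def, Complex.conj_ofReal]
        simp only [sub_mul, mul_sub, smul_mul_assoc, mul_smul_comm, one_mul, mul_one, smul_smul,
          smul_sub]
        rw [← pow_succ', ← pow_succ, ← pow_succ]
        push_cast
        rw [two_mul, add_smul, ← sq]
        abel
      rw [e] at h2
      simp only [Matrix.add_apply, Matrix.sub_apply, Matrix.smul_apply, smul_eq_mul,
        Complex.add_re, Complex.sub_re, Complex.re_ofReal_mul, Complex.zero_re] at h2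
      nlinarith
  induction q with
  | zero => simp
  | succ q ih =>
    refine le_trans ?_ (hstep q)
    rw [pow_succ']
    gcongr

end Fin

section Main

variable {Ω : Type} [MeasurableSpace Ω]

lemma suff {n m : ℕ} (d : Fin (n + 1) → ℂ) (C : Matrix (Fin m) (Fin (n + 1)) ℂ)
    (hsort : ∀ i j : Fin (n + 1), i ≤ j → ‖d j‖ ≤ ‖d i‖)
    (hunst : ∀ i, 1 < ‖d i‖)
    (hnd : NonDeg d C)
    (μ : Measure Ω) [IsProbabilityMeasure μ]
    (γ : ℕ → Ω → ℝ) (p : ℝ) (hp : p ∈ Set.Ioc (0 : ℝ) 1)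
    (hmeas : ∀ k, Measurable (γ k))
    (hind : iIndepFun γ μ)
    (h01 : ∀ k ω, γ k ω = 0 ∨ γ k ω = 1)
    (hber : ∀ k, μ {ω | γ k ω = 1} = ENNReal.ofReal p)
    (q : ℕ) (h : 1 - (‖d 0‖ ^ (2 * q))⁻¹ < p) :
    EBounded μ (fun k ω =>
        (ricc (Matrix.diagonal d) C 1 1 1 (fun i => γ i ω) k) ^ q) := by
  have hpos : 0 < ‖d 0‖ ^ (2 * q) := by have := hunst 0; positivity
  have hβ : (1 - p) * ‖d 0‖ ^ (2 * q) < 1 := by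
    rw [← lt_div_iff₀ hpos, one_div]; linarith
  obtain ⟨Z, D, M, hD, hM, hZm, hZ1, hZM, hB, -⟩ := GG_all hnd (fun i => hsort 0 i (Fin.zero_le i))
    (fun i => (hunst i).le) (hunst 0) hp hmeas hind h01 hber hβ
  have hent : ∀ ω k i j, ‖ricc (Matrix.diagonal d) C 1 1 1 (fun i => γ i ω) k i j‖ ≤ Z k ω ^ 2 := by
    intro ω k i j
    set P := ricc (Matrix.diagonal d) C 1 1 1 (fun i => γ i ω) k with hP
    have hz := hZ1 k ω
    have key : ∀ i, ‖P i j‖ ≤ Z k ω * √ (P j j).re := by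
      intro i
      have := hB ω k (P *ᵥ Pi.single j 1) _ ⟨Pi.single j 1, rfl, rfl⟩ 0 le_rfl
        (fun l hl => absurd (Finset.mem_univ l) hl) i (Finset.mem_univ i)
      simpa [← hP, Pi.star_single] using this
    have h0 : 0 ≤ √ (P j j).re := Real.sqrt_nonneg _
    have hPp : P.PosSemidef := ricc_psd _ _ _ (fun k => h01 k ω) k
    have hj0 : 0 ≤ (P j j).re := (Complex.le_def.1 hPp.diag_nonneg).1
    have h1 : √ (P j j).re * √ (P j j).re ≤ Z k ω * √ (P j j).re := by
      rw [Real.mul_self_sqrt hj0]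
      exact (Complex.re_le_norm _).trans (key j)
    have h2 : √ (P j j).re ≤ Z k ω := by
      by_contra hc
      push Not at hc
      nlinarith
    refine (key i).trans ?_
    rw [sq]; gcongr
  refine ⟨fun k i j => ricc_int _ _ hmeas h01 k (fun P => (P ^ q) i j), ?_⟩
  set B : ℝ := ((n + 1 : ℕ) : ℝ) ^ q * M with hBd
  refine ⟨((Fintype.card (Fin (n + 1)) * B : ℝ) : ℂ) • 1, ?_, fun k => ?_⟩
  · rw [Matrix.IsHermitian, Matrix.conjTranspose_smul, Matrix.conjTranspose_one, RCLike.star_def,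
      Complex.conj_ofReal]
  · apply loe_of_entry
    · ext i j
      rw [Matrix.conjTranspose_apply]
      simp only [matExp, Matrix.of_apply]
      rw [RCLike.star_def, ← integral_conj]
      congr 1
      funext ω
      have hPp : (ricc (Matrix.diagonal d) C 1 1 1 (fun i => γ i ω) k).PosSemidef :=
        ricc_psd _ _ _ (fun k => h01 k ω) k
      exact (hPp.isHermitian.pow q).apply i j
    · intro i j
      simp only [matExp, Matrix.of_apply]
      refine (norm_integral_le_lintegral_norm _).trans ?_
      refine ENNReal.toReal_le_of_le_ofReal (by positivity) ?_
      calc ∫⁻ ω, ENNReal.ofReal ‖(ricc (Matrix.diagonal d) C 1 1 1 (fun i => γ i ω) k ^ q) i j‖ ∂μ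
          ≤ ∫⁻ ω, ENNReal.ofReal (((n + 1 : ℕ) : ℝ) ^ q) * ENNReal.ofReal (Z k ω ^ (2 * q)) ∂μ := by
            refine lintegral_mono fun ω => ?_
            rw [← ENNReal.ofReal_mul (by positivity)]
            apply ENNReal.ofReal_le_ofReal
            refine (pow_entry _ (by positivity) (hent ω k) q i j).trans (le_of_eq ?_)
            rw [Fintype.card_fin, mul_pow, ← pow_mul]
        _ = ENNReal.ofReal (((n + 1 : ℕ) : ℝ) ^ q) * ∫⁻ ω, ENNReal.ofReal (Z k ω ^ (2 * q)) ∂μ :=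
            lintegral_const_mul' _ _ ENNReal.ofReal_ne_top
        _ ≤ _ := by
            rw [hBd, ENNReal.ofReal_mul (by positivity)]
            gcongr
            exact hZM k

lemma nec {n m : ℕ} (d : Fin (n + 1) → ℂ) (C : Matrix (Fin m) (Fin (n + 1)) ℂ)
    (hunst : ∀ i, 1 < ‖d i‖)
    (μ : Measure Ω) [IsProbabilityMeasure μ]
    (γ : ℕ → Ω → ℝ) (p : ℝ) (hp : p ∈ Set.Ioc (0 : ℝ) 1)
    (hmeas : ∀ k, Measurable (γ k))
    (hind : iIndepFun γ μ)
    (h01 : ∀ k ω, γ k ω = 0 ∨ γ k ω = 1)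
    (hber : ∀ k, μ {ω | γ k ω = 1} = ENNReal.ofReal p)
    (q : ℕ) (hq : 1 ≤ q) 
    (hE : EBounded μ (fun k ω =>
        (ricc (Matrix.diagonal d) C 1 1 1 (fun i => γ i ω) k) ^ q)) :
    1 - (‖d 0‖ ^ (2 * q))⁻¹ < p := by
  by_contra hlt
  push Not at hlt
  have hpos : 0 < ‖d 0‖ ^ (2 * q) := by have := hunst 0; positivity
  have hβ : 1 ≤ ‖d 0‖ ^ (2 * q) * (1 - p) := by
    rw [← div_le_iff₀' hpos, one_div]; linarith
  obtain ⟨-, M, -, hM⟩ := hE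
  set P : ℕ → Ω → Matrix (Fin (n + 1)) (Fin (n + 1)) ℂ :=
    fun k ω => ricc (Matrix.diagonal d) C 1 1 1 (fun i => γ i ω) k with hPd
  have hPp : ∀ k ω, (P k ω).PosSemidef := fun k ω => ricc_psd _ _ _ (fun k => h01 k ω) k
  have h0 : ∀ k ω, 0 ≤ (P k ω 0 0).re := fun k ω => (Complex.le_def.1 (hPp k ω).diag_nonneg).1
  have hge1 : ∀ k ω, 1 ≤ (P (k + 1) ω 0 0).re := by
    intro k ω
    have hSu := (Matrix.isUnit_iff_isUnit_det _).1 (psd_S C _ (hPp k ω)).isUnit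
    obtain ⟨u', -, h2⟩ := riccStep_decomp (Matrix.diagonal d) C (P k ω) hSu (γ k ω) (h01 k ω)
      (Pi.single 0 1)
    have h3 := congrArg Complex.re h2
    have n1 : 0 ≤ (star u' ⬝ᵥ (P k ω *ᵥ u')).re :=
      (Complex.le_def.1 ((hPp k ω).dotProduct_mulVec_nonneg u')).1
    have n2 : 0 ≤ (star (C *ᵥ (P k ω *ᵥ u')) ⬝ᵥ (C *ᵥ (P k ω *ᵥ u'))).re := by
      rw [self_dot]; positivity
    have n4 : 0 ≤ γ k ω * (star (C *ᵥ (P k ω *ᵥ u')) ⬝ᵥ (C *ᵥ (P k ω *ᵥ u'))).re := by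
      rcases h01 k ω with h | h <;> rw [h] <;> linarith
    have e : P (k + 1) ω = riccStep (Matrix.diagonal d) C 1 1 (γ k ω) (P k ω) := rfl
    rw [← e, Complex.add_re, Complex.add_re, Complex.re_ofReal_mul] at h3
    have e1 : (star (Pi.single 0 1 : Fin (n + 1) → ℂ) ⬝ᵥ (P (k + 1) ω *ᵥ Pi.single 0 1)) =
        P (k + 1) ω 0 0 := by simp [Pi.star_single]
    have e2 : (star (Pi.single 0 1 : Fin (n + 1) → ℂ) ⬝ᵥ (Pi.single 0 1)) = 1 := by
      simp [Pi.star_single]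
    rw [e1, e2, Complex.one_re] at h3
    linarith
  have hstep : ∀ k ω, γ k ω ≠ 1 → (P (k + 1) ω 0 0).re = ‖d 0‖ ^ 2 * (P k ω 0 0).re + 1 := by
    intro k ω hk
    have hk0 : γ k ω = 0 := (h01 k ω).resolve_right hk
    have e : P (k + 1) ω = riccStep (Matrix.diagonal d) C 1 1 (γ k ω) (P k ω) := rfl
    have e2 : d 0 * P k ω 0 0 * (starRingEnd ℂ) (d 0) = ((‖d 0‖ ^ 2 : ℝ) : ℂ) * P k ω 0 0 := by
      push_cast
      rw [← Complex.mul_conj']; ring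
    rw [e, riccStep, hk0]
    simp only [Complex.ofReal_zero, zero_smul, sub_zero, Matrix.add_apply, Matrix.one_apply_eq,
      Matrix.diagonal_conjTranspose, Matrix.mul_diagonal, Matrix.diagonal_mul, Pi.star_apply,
      RCLike.star_def, e2, Complex.add_re, Complex.re_ofReal_mul, Complex.one_re]
  set y : ℕ → ℝ≥0∞ := fun k => ∫⁻ ω, ENNReal.ofReal ((P k ω 0 0).re ^ q) ∂μ with hy
  have hyk : ∀ k, y k + 1 ≤ y (k + 1) := by
    intro k
    have hfm : Measurable[mF γ k] (fun ω => ENNReal.ofReal ((P k ω 0 0).re ^ q)) := by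
      intro s _
      exact ricc_meas (Matrix.diagonal d) C h01 k
        ((fun X => ENNReal.ofReal ((X 0 0).re ^ q)) ⁻¹' s)
    have hpt : ∀ ω, ENNReal.ofReal (‖d 0‖ ^ (2 * q)) * (ENNReal.ofReal ((P k ω 0 0).re ^ q) *
        {ω | γ k ω = 1}ᶜ.indicator 1 ω) + 1 ≤ ENNReal.ofReal ((P (k + 1) ω 0 0).re ^ q) := by
      intro ω
      by_cases hω : γ k ω = 1
      · simpa [Set.indicator, hω] using one_le_pow₀ (hge1 k ω)
      · rw [hstep k ω hω]
        have e : {ω | γ k ω = 1}ᶜ.indicator (1 : Ω → ℝ≥0∞) ω = 1 := by simp [Set.indicator, hω]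
        have := h0 k ω
        rw [e, mul_one, ← ENNReal.ofReal_mul (by positivity), ← ENNReal.ofReal_one,
          ← ENNReal.ofReal_add (by positivity) zero_le_one]
        apply ENNReal.ofReal_le_ofReal
        have := pow_add_pow_le (n := q) (show 0 ≤ ‖d 0‖ ^ 2 * (P k ω 0 0).re by positivity)
          zero_le_one (by omega)
        rwa [mul_pow, ← pow_mul, one_pow] at this
    calc y k + 1 ≤ ENNReal.ofReal (‖d 0‖ ^ (2 * q)) * (y k * ENNReal.ofReal (1 - p)) + 1 := by
          gcongr
          have : (1 : ℝ≥0∞) ≤ ENNReal.ofReal (‖d 0‖ ^ (2 * q)) * ENNReal.ofReal (1 - p) := by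
            rw [← ENNReal.ofReal_mul hpos.le, ← ENNReal.ofReal_one]
            exact ENNReal.ofReal_le_ofReal hβ
          calc y k = 1 * y k := (one_mul _).symm
            _ ≤ (ENNReal.ofReal (‖d 0‖ ^ (2 * q)) * ENNReal.ofReal (1 - p)) * y k := by gcongr
            _ = _ := by ring
      _ = ∫⁻ ω, (ENNReal.ofReal (‖d 0‖ ^ (2 * q)) * (ENNReal.ofReal ((P k ω 0 0).re ^ q) *
        {ω | γ k ω = 1}ᶜ.indicator 1 ω) + 1) ∂μ := by
          rw [lintegral_add_right _ measurable_const, lintegral_const_mul' _ _ ENNReal.ofReal_ne_top,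
            lint_indep hp.1.le hmeas hind hber k _ hfm]
          simp [hy]
      _ ≤ y (k + 1) := lintegral_mono hpt
  have hyn : ∀ k : ℕ, (k : ℝ≥0∞) ≤ y k := by
    intro k
    induction k with
    | zero => simp
    | succ k ih => push_cast; exact le_trans (by gcongr) (hyk k)
  have hup : ∀ k, y k ≤ ENNReal.ofReal (M 0 0).re := by
    intro k
    have hI : Integrable (fun ω => (P k ω ^ q) 0 0) μ :=
      ricc_int _ _ hmeas h01 k (fun P => (P ^ q) 0 0)
    have h1 := (Complex.le_def.1 ((hM k).diag_nonneg (i := 0))).1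
    simp only [Matrix.sub_apply, matExp, Matrix.of_apply, Complex.sub_re, Complex.zero_re] at h1
    have h2 : ∫ ω, ((P k ω ^ q) 0 0).re ∂μ = (∫ ω, (P k ω ^ q) 0 0 ∂μ).re := integral_re hI
    calc y k ≤ ∫⁻ ω, ENNReal.ofReal (((P k ω ^ q) 0 0).re) ∂μ :=
          lintegral_mono fun ω => ENNReal.ofReal_le_ofReal (psd_pow_diag _ (hPp k ω) 0 q)
      _ = ENNReal.ofReal (∫ ω, ((P k ω ^ q) 0 0).re ∂μ) := by
          have hI' : Integrable (fun ω => ((P k ω ^ q) 0 0).re) μ := hI.re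
          refine (ofReal_integral_eq_lintegral_ofReal hI' ?_).symm
          exact ae_of_all _ fun ω => le_trans (pow_nonneg (h0 k ω) q)
            (psd_pow_diag _ (hPp k ω) 0 q)
      _ ≤ _ := by
          apply ENNReal.ofReal_le_ofReal
          rw [h2]; linarith
  obtain ⟨k, hk⟩ := ENNReal.exists_nat_gt (ENNReal.ofReal_ne_top (r := (M 0 0).re))
  exact absurd ((hyn k).trans (hup k)) (not_le.2 hk)

end Main

/-- higher moments.  For a detectable non-degenerate system with all eigenvalues
unstable and identity noise parameters, `sup_k E[P_k^q]` is bounded iff `p > 1 − |λ₁|^{−2q}`. -/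
theorem stmt12 {n m : ℕ} (d : Fin (n + 1) → ℂ) (C : Matrix (Fin m) (Fin (n + 1)) ℂ)
    (hsort : ∀ i j : Fin (n + 1), i ≤ j → ‖d j‖ ≤ ‖d i‖)
    (hunst : ∀ i, 1 < ‖d i‖)
    (hdet : Detectable (Matrix.diagonal d) C)
    (hnd : NonDeg d C)
    {Ω : Type} [MeasurableSpace Ω] (μ : Measure Ω) [IsProbabilityMeasure μ]
    (γ : ℕ → Ω → ℝ) (p : ℝ) (hp : p ∈ Set.Ioc (0 : ℝ) 1)
    (hmeas : ∀ k, Measurable (γ k))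
    (hind : iIndepFun γ μ)
    (h01 : ∀ k ω, γ k ω = 0 ∨ γ k ω = 1)
    (hber : ∀ k, μ {ω | γ k ω = 1} = ENNReal.ofReal p)
    (q : ℕ) (hq : 1 ≤ q) :
    EBounded μ (fun k ω =>
        (ricc (Matrix.diagonal d) C 1 1 1 (fun i => γ i ω) k) ^ q) ↔
      1 - (‖d 0‖ ^ (2 * q))⁻¹ < p := by
  exact ⟨fun h => nec d C hunst μ γ p hp hmeas hind h01 hber q hq h,
    fun h => suff d C hsort hunst hnd μ γ p hp hmeas hind h01 hber q h⟩
end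

section
/- Let A = diag(λ₁, λ₂) be a 2×2 complex diagonal matrix with |λ₁| = |λ₂| = λ > 1 and λ₂ = λ₁·e^{iφ} with φ ∈ (0, 2π), and suppose φ/(2π) = r/q with r, q positive coprime integers, r < q. Let C ∈ ℂ^{m×2} with rank(C) = 1 and (C,A) detectable (degenerate system). Let Q, R, Σ₀ be Hermitian positive definite, (γ_k) i.i.d. Bernoulli with P(γ_k = 1) = p, and let P_k be the associated Riccati recursion. Then the critical value is p_c = 1 − λ^{−2q/(q−1)}: if p > 1 − λ^{−2q/(q−1)} then sup_k E[P_k] is bounded for every initial condition, and if p < 1 − λ^{−2q/(q−1)} then sup_k E[P_k] is unbounded for some initial condition. -/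
open Matrix MeasureTheory ProbabilityTheory
open scoped ComplexOrder ENNReal

set_option linter.unusedSectionVars false
set_option linter.unusedDecidableInType false
set_option linter.unusedFintypeInType false

section Det
variable {ι κ : Type} [Fintype ι] [Fintype κ] [DecidableEq ι] [DecidableEq κ]

/-- real quadratic form -/
noncomputable def qf (X : Matrix ι ι ℂ) (a : ι → ℂ) : ℝ := (star a ⬝ᵥ (X *ᵥ a)).re

lemma qf_nonneg {X : Matrix ι ι ℂ} (h : X.PosSemidef) (a : ι → ℂ) : 0 ≤ qf X a :=
  (Complex.le_def.1 (h.dotProduct_mulVec_nonneg a)).1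

lemma qf_add (X Y : Matrix ι ι ℂ) (a : ι → ℂ) : qf (X + Y) a = qf X a + qf Y a := by
  simp [qf, add_mulVec, dotProduct_add]

lemma qf_sub (X Y : Matrix ι ι ℂ) (a : ι → ℂ) : qf (X - Y) a = qf X a - qf Y a := by
  simp [qf, sub_mulVec, dotProduct_sub]

lemma qf_mono {X Y : Matrix ι ι ℂ} (h : (Y - X).PosSemidef) (a : ι → ℂ) : qf X a ≤ qf Y a := by
  have := qf_nonneg h a
  rw [qf_sub] at this; linarith

lemma qf_conj (B : Matrix κ ι ℂ) (X : Matrix ι ι ℂ) (a : κ → ℂ) :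
    qf (B * X * Bᴴ) a = qf X (Bᴴ *ᵥ a) := by
  unfold qf
  rw [star_mulVec, conjTranspose_conjTranspose, ← mulVec_mulVec, ← mulVec_mulVec,
    dotProduct_mulVec, ]

lemma qf_vadd {X : Matrix ι ι ℂ} (h : X.PosSemidef) (a b : ι → ℂ) :
    qf X (a + b) ≤ 2 * qf X a + 2 * qf X b := by
  have h1 := qf_nonneg h (a - b)
  have h2 : qf X (a + b) + qf X (a - b) = 2 * qf X a + 2 * qf X b := by
    simp only [qf, star_add, star_sub, mulVec_add, mulVec_sub, dotProduct_add, dotProduct_sub,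
      add_dotProduct, sub_dotProduct, Complex.add_re, Complex.sub_re]
    ring
  linarith

lemma qf_vsmul (X : Matrix ι ι ℂ) (c : ℂ) (a : ι → ℂ) :
    qf X (c • a) = ‖c‖ ^ 2 * qf X a := by
  have : star (c • a) ⬝ᵥ (X *ᵥ (c • a)) = ((‖c‖ ^ 2 : ℝ) : ℂ) * (star a ⬝ᵥ (X *ᵥ a)) := by
    rw [star_smul, mulVec_smul, smul_dotProduct, dotProduct_smul, smul_eq_mul, smul_eq_mul,
      ← mul_assoc]
    congr 1
    have := Complex.conj_mul' c
    push_cast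
    exact this
  unfold qf
  rw [this, Complex.re_ofReal_mul]

variable (A : Matrix ι ι ℂ) (C : Matrix κ ι ℂ) (Q : Matrix ι ι ℂ) (R : Matrix κ κ ℂ)

/-- measurement update -/
noncomputable def upd (X : Matrix ι ι ℂ) : Matrix ι ι ℂ :=
  X - X * Cᴴ * (C * X * Cᴴ + R)⁻¹ * (C * X)

lemma posDef_S {X : Matrix ι ι ℂ} (hR : R.PosDef) (hX : X.PosSemidef) :
    (C * X * Cᴴ + R).PosDef :=
  PosDef.posSemidef_add (hX.mul_mul_conjTranspose_same C) hR

lemma upd_joseph {X : Matrix ι ι ℂ} (hR : R.PosDef) (hX : X.PosSemidef) :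
    ∃ K : Matrix ι κ ℂ, upd C R X = (1 - K * C) * X * (1 - K * C)ᴴ + K * R * Kᴴ := by
  have hS := posDef_S C R hR hX
  set S := C * X * Cᴴ + R with hSdef
  have hu : IsUnit S.det := (Matrix.isUnit_iff_isUnit_det _).1 hS.isUnit
  refine ⟨X * Cᴴ * S⁻¹, ?_⟩
  set K := X * Cᴴ * S⁻¹ with hK
  have hKS : K * S = X * Cᴴ := by rw [hK, Matrix.mul_assoc, Matrix.nonsing_inv_mul _ hu, Matrix.mul_one]
  have hR' : R = S - C * X * Cᴴ := by rw [hSdef]; simp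
  have e1 : K * R * Kᴴ = X * Cᴴ * Kᴴ - K * (C * X * Cᴴ) * Kᴴ := by
    rw [hR', Matrix.mul_sub, Matrix.sub_mul, hKS]
  rw [e1, upd, ← hSdef, ← hK, conjTranspose_sub, conjTranspose_one, conjTranspose_mul]
  simp only [Matrix.mul_sub, Matrix.sub_mul, Matrix.mul_one, Matrix.one_mul, Matrix.mul_assoc]
  abel

lemma upd_psd {X : Matrix ι ι ℂ} (hR : R.PosDef) (hX : X.PosSemidef) :
    (upd C R X).PosSemidef := by
  obtain ⟨K, hK⟩ := upd_joseph C R hR hX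
  rw [hK]
  exact (hX.mul_mul_conjTranspose_same _).add (hR.posSemidef.mul_mul_conjTranspose_same _)

lemma upd_le {X : Matrix ι ι ℂ} (hR : R.PosDef) (hX : X.PosSemidef) :
    (X - upd C R X).PosSemidef := by
  have hS := (posDef_S C R hR hX).inv.posSemidef
  have := hS.mul_mul_conjTranspose_same (X * Cᴴ)
  rw [conjTranspose_mul, conjTranspose_conjTranspose, hX.isHermitian.eq] at this
  simpa [upd] using this

lemma upd_meas {X : Matrix ι ι ℂ} (hR : R.PosDef) (hX : X.PosSemidef) :
    (R - C * upd C R X * Cᴴ).PosSemidef := by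
  have hS := posDef_S C R hR hX
  have hp := hS.inv.posSemidef.mul_mul_conjTranspose_same R
  rw [hR.isHermitian.eq] at hp
  have hu : IsUnit (C * X * Cᴴ + R).det := (Matrix.isUnit_iff_isUnit_det _).1 hS.isUnit
  suffices hs : R - C * upd C R X * Cᴴ = R * (C * X * Cᴴ + R)⁻¹ * R by rw [hs]; exact hp
  clear hp hS hR
  set W := C * X * Cᴴ with hW
  set S := W + R with hSdef
  have hR' : R = S - W := by rw [hSdef]; simp
  have e : C * upd C R X * Cᴴ = W - W * S⁻¹ * W := by
    rw [upd, ← hW, ← hSdef]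
    simp only [Matrix.mul_sub, Matrix.sub_mul, Matrix.mul_assoc, hW]
  rw [e, hR']
  simp only [Matrix.mul_sub, Matrix.sub_mul, Matrix.mul_nonsing_inv _ hu, Matrix.one_mul,
    Matrix.mul_assoc, Matrix.nonsing_inv_mul _ hu, Matrix.mul_one]

lemma conj_vec (B : Matrix κ ι ℂ) (a : ι → ℂ) :
    B * vecMulVec a (star a) * Bᴴ = vecMulVec (B *ᵥ a) (star (B *ᵥ a)) := by
  rw [mul_vecMulVec, vecMulVec_mul, star_mulVec]

lemma upd_lower {X : Matrix ι ι ℂ} (hR : R.PosDef) (hX : X.PosSemidef) (a : ι → ℂ)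
    (ha : C *ᵥ a = 0) (h : (X - vecMulVec a (star a)).PosSemidef) :
    (upd C R X - vecMulVec a (star a)).PosSemidef := by
  obtain ⟨K, hK⟩ := upd_joseph C R hR hX
  have h1 := (h.mul_mul_conjTranspose_same (1 - K * C)).add
    (hR.posSemidef.mul_mul_conjTranspose_same K)
  rw [Matrix.mul_sub, Matrix.sub_mul, conj_vec] at h1
  have : (1 - K * C) *ᵥ a = a := by
    rw [sub_mulVec, ← mulVec_mulVec, ha]; simp
  rw [this] at h1
  rw [hK]
  convert h1 using 1
  abel

lemma riccStep_zero (X : Matrix ι ι ℂ) : riccStep A C Q R 0 X = A * X * Aᴴ + Q := by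
  simp [riccStep]

lemma riccStep_one (X : Matrix ι ι ℂ) : riccStep A C Q R 1 X = A * upd C R X * Aᴴ + Q := by
  simp only [riccStep, upd, Matrix.mul_sub, Matrix.sub_mul, Matrix.mul_assoc, Complex.ofReal_one,
    one_smul]
  abel

lemma riccStep_psd_s13 (hQ : Q.PosDef) (hR : R.PosDef) {X : Matrix ι ι ℂ} (hX : X.PosSemidef) {g : ℝ}
    (hg : g = 0 ∨ g = 1) : (riccStep A C Q R g X).PosSemidef := by
  rcases hg with rfl | rfl
  · rw [riccStep_zero]; exact (hX.mul_mul_conjTranspose_same _).add hQ.posSemidef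
  · rw [riccStep_one]
    exact ((upd_psd C R hR hX).mul_mul_conjTranspose_same _).add hQ.posSemidef

lemma ricc_psd_s13 (hQ : Q.PosDef) (hR : R.PosDef) {X : Matrix ι ι ℂ} (hX : X.PosSemidef) {γ : ℕ → ℝ}
    (hg : ∀ k, γ k = 0 ∨ γ k = 1) (k : ℕ) : (ricc A C Q R X γ k).PosSemidef := by
  induction k with
  | zero => exact hX
  | succ k ih => exact riccStep_psd_s13 A C Q R hQ hR ih (hg k)

lemma ricc_lower (hQ : Q.PosDef) (hR : R.PosDef) (a : ι → ℂ) {γ : ℕ → ℝ}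
    (hg : ∀ k, γ k = 0 ∨ γ k = 1) (k : ℕ)
    (h : ∀ t < k, γ t = 1 → C *ᵥ (A ^ t *ᵥ a) = 0) :
    (ricc A C Q R (vecMulVec a (star a)) γ k
      - vecMulVec (A ^ k *ᵥ a) (star (A ^ k *ᵥ a))).PosSemidef := by
  induction k with
  | zero => simpa [ricc] using PosSemidef.zero
  | succ k ih =>
    have ih := ih (fun t ht => h t (by omega))
    have hX := ricc_psd_s13 A C Q R hQ hR (posSemidef_vecMulVec_self_star a) hg k
    have key : ∀ Y : Matrix ι ι ℂ, (Y - vecMulVec (A ^ k *ᵥ a) (star (A ^ k *ᵥ a))).PosSemidef →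
      (A * Y * Aᴴ + Q
        - vecMulVec (A ^ (k+1) *ᵥ a) (star (A ^ (k+1) *ᵥ a))).PosSemidef := by
      intro Y hY
      have h1 := (hY.mul_mul_conjTranspose_same A).add hQ.posSemidef
      rw [Matrix.mul_sub, Matrix.sub_mul, conj_vec, mulVec_mulVec, ← pow_succ'] at h1
      convert h1 using 1
      abel
    rw [ricc]
    rcases hg k with h0 | h1
    · rw [h0, riccStep_zero]; exact key _ ih
    · rw [h1, riccStep_one]
      exact key _ (upd_lower C R hR hX _ (h k (by omega) h1) ih)

lemma ricc_add (X : Matrix ι ι ℂ) (γ : ℕ → ℝ) (k l : ℕ) :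
    ricc A C Q R X γ (k + l) = ricc A C Q R (ricc A C Q R X γ k) (fun i => γ (k + i)) l := by
  induction l with
  | zero => rfl
  | succ l ih => rw [← add_assoc, ricc, ih, ricc]

lemma ricc_congr (X : Matrix ι ι ℂ) (γ γ' : ℕ → ℝ) (k : ℕ) (h : ∀ i < k, γ i = γ' i) :
    ricc A C Q R X γ k = ricc A C Q R X γ' k := by
  induction k with
  | zero => rfl
  | succ k ih => rw [ricc, ricc, ih (fun i hi => h i (by omega)), h k (by omega)]

/-- directions with uniformly bounded variance -/
def Bd (γ : ℕ → ℝ) (k : ℕ) (b : ι → ℂ) : Prop :=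
  ∃ M : ℝ, ∀ X : Matrix ι ι ℂ, X.PosSemidef → qf (ricc A C Q R X γ k) b ≤ M

lemma Bd_add (hQ : Q.PosDef) (hR : R.PosDef) {γ : ℕ → ℝ}
    (hg : ∀ k, γ k = 0 ∨ γ k = 1) {k : ℕ} {a b : ι → ℂ} (ha : Bd A C Q R γ k a)
    (hb : Bd A C Q R γ k b) : Bd A C Q R γ k (a + b) := by
  obtain ⟨M, hM⟩ := ha
  obtain ⟨N, hN⟩ := hb
  refine ⟨2 * M + 2 * N, fun X hX => ?_⟩
  have := qf_vadd (ricc_psd_s13 A C Q R hQ hR hX hg k) a b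
  linarith [hM X hX, hN X hX]

lemma Bd_smul {γ : ℕ → ℝ} {k : ℕ} (c : ℂ) {a : ι → ℂ} (ha : Bd A C Q R γ k a) :
    Bd A C Q R γ k (c • a) := by
  obtain ⟨M, hM⟩ := ha
  refine ⟨‖c‖ ^ 2 * M, fun X hX => ?_⟩
  rw [qf_vsmul]
  exact mul_le_mul_of_nonneg_left (hM X hX) (by positivity)

lemma riccStep_le (hR : R.PosDef) {X : Matrix ι ι ℂ} (hX : X.PosSemidef) {g : ℝ}
    (hg : g = 0 ∨ g = 1) : (A * X * Aᴴ + Q - riccStep A C Q R g X).PosSemidef := by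
  rcases hg with rfl | rfl
  · rw [riccStep_zero]; simpa using PosSemidef.zero
  · rw [riccStep_one]
    have := (upd_le C R hR hX).mul_mul_conjTranspose_same A
    simpa [Matrix.mul_sub, Matrix.sub_mul] using this

lemma Bd_step (hQ : Q.PosDef) (hR : R.PosDef) {γ : ℕ → ℝ}
    (hg : ∀ k, γ k = 0 ∨ γ k = 1) {k : ℕ} {b : ι → ℂ}
    (hb : Bd A C Q R γ k (Aᴴ *ᵥ b)) : Bd A C Q R γ (k + 1) b := by
  obtain ⟨M, hM⟩ := hb
  refine ⟨M + qf Q b, fun X hX => ?_⟩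
  have h1 := qf_mono (riccStep_le A C Q R hR (ricc_psd_s13 A C Q R hQ hR hX hg k) (hg k)) b
  rw [qf_add, qf_conj] at h1
  rw [ricc]
  linarith [hM X hX]

lemma Bd_meas (hQ : Q.PosDef) (hR : R.PosDef) {γ : ℕ → ℝ}
    (hg : ∀ k, γ k = 0 ∨ γ k = 1) {k : ℕ} (hk : γ k = 1) {b : ι → ℂ} (y : κ → ℂ)
    (hb : Aᴴ *ᵥ b = Cᴴ *ᵥ y) : Bd A C Q R γ (k + 1) b := by
  refine ⟨qf R y + qf Q b, fun X hX => ?_⟩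
  have h1 := qf_mono (upd_meas C R hR (ricc_psd_s13 A C Q R hQ hR hX hg k)) y
  rw [qf_conj] at h1
  rw [ricc, hk, riccStep_one, qf_add, qf_conj, hb]
  linarith

end Det

section Two
variable {m : ℕ}

lemma span_two (u v : Fin 2 → ℂ) (h : u 0 * v 1 - u 1 * v 0 ≠ 0) (b : Fin 2 → ℂ) :
    ∃ α β : ℂ, b = α • u + β • v := by
  refine ⟨(b 0 * v 1 - b 1 * v 0) / (u 0 * v 1 - u 1 * v 0),
    (u 0 * b 1 - u 1 * b 0) / (u 0 * v 1 - u 1 * v 0), ?_⟩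
  ext j
  fin_cases j
  · simp only [Fin.zero_eta, Pi.add_apply, Pi.smul_apply, smul_eq_mul]
    rw [div_mul_eq_mul_div, div_mul_eq_mul_div, ← add_div, eq_div_iff h]; ring
  · simp only [Fin.mk_one, Pi.add_apply, Pi.smul_apply, smul_eq_mul]
    rw [div_mul_eq_mul_div, div_mul_eq_mul_div, ← add_div, eq_div_iff h]; ring

lemma trace_qf (X : Matrix (Fin 2) (Fin 2) ℂ) :
    X.trace.re = qf X (Pi.single 0 1) + qf X (Pi.single 1 1) := by
  simp [qf, Matrix.trace, Fin.sum_univ_two]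

lemma trace_conj (l1 l2 : ℂ) (Lam : ℝ) (hl1 : ‖l1‖ = Lam) (hl2 : ‖l2‖ = Lam)
    (X : Matrix (Fin 2) (Fin 2) ℂ) :
    (Matrix.diagonal ![l1, l2] * X * (Matrix.diagonal ![l1, l2])ᴴ).trace.re
      = Lam ^ 2 * X.trace.re := by
  have h1 : l1 * star l1 = ((Lam ^ 2 : ℝ) : ℂ) := by
    rw [← hl1]; push_cast; exact Complex.mul_conj' l1
  have h2 : l2 * star l2 = ((Lam ^ 2 : ℝ) : ℂ) := by
    rw [← hl2]; push_cast; exact Complex.mul_conj' l2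
  have : (Matrix.diagonal ![l1, l2] * X * (Matrix.diagonal ![l1, l2])ᴴ).trace
      = ((Lam ^ 2 : ℝ) : ℂ) * X.trace := by
    rw [diagonal_conjTranspose]
    simp only [Matrix.trace, Fin.sum_univ_two, Matrix.diag_apply, Matrix.mul_diagonal,
      Matrix.diagonal_mul, Pi.star_apply, Matrix.cons_val_zero, Matrix.cons_val_one]
    linear_combination (X 0 0) * h1 + (X 1 1) * h2
  rw [this, Complex.re_ofReal_mul]

lemma trace_mono {X Y : Matrix (Fin 2) (Fin 2) ℂ} (h : (Y - X).PosSemidef) :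
    X.trace.re ≤ Y.trace.re := by
  rw [trace_qf, trace_qf]
  linarith [qf_mono h (Pi.single 0 1), qf_mono h (Pi.single 1 1)]

lemma trace_nn {X : Matrix (Fin 2) (Fin 2) ℂ} (h : X.PosSemidef) : 0 ≤ X.trace.re := by
  rw [trace_qf]
  linarith [qf_nonneg h (Pi.single 0 1), qf_nonneg h (Pi.single 1 1)]

lemma psd_trace {X : Matrix (Fin 2) (Fin 2) ℂ} (h : X.PosSemidef) (B : ℝ) (hB : X.trace.re ≤ B) :
    ((B : ℂ) • (1 : Matrix (Fin 2) (Fin 2) ℂ) - X).PosSemidef := by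
  have h1 := h.transpose.mul_mul_conjTranspose_same (!![0, 1; -1, 0] : Matrix (Fin 2) (Fin 2) ℂ)
  have him : X.trace = (X.trace.re : ℂ) := by
    have := h.trace_nonneg
    rw [Complex.le_def] at this
    apply Complex.ext
    · simp
    · simpa using this.2.symm
  have e : (B : ℂ) • (1 : Matrix (Fin 2) (Fin 2) ℂ) - X =
     ((B - X.trace.re : ℝ) : ℂ) • (1 : Matrix (Fin 2) (Fin 2) ℂ)
      + (!![0, 1; -1, 0] : Matrix (Fin 2) (Fin 2) ℂ) * Xᵀ * (!![0, 1; -1, 0])ᴴ := by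
    push_cast
    rw [← him]
    ext i j
    fin_cases i <;> fin_cases j <;>
      simp [Matrix.mul_apply, Matrix.trace, Fin.sum_univ_two, Matrix.vecMul, vecHead, vecTail] <;> ring
  rw [e]
  refine PosSemidef.add (PosSemidef.smul PosSemidef.one ?_) h1
  rw [Complex.zero_le_real]; linarith

variable (l1 l2 : ℂ) (Lam : ℝ) (q : ℕ)
  (C : Matrix (Fin m) (Fin 2) ℂ) (Q : Matrix (Fin 2) (Fin 2) ℂ) (R : Matrix (Fin m) (Fin m) ℂ)

lemma trace_growth (hl1 : ‖l1‖ = Lam) (hl2 : ‖l2‖ = Lam) (hQ : Q.PosDef) (hR : R.PosDef) (L : ℕ) :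
    ∃ c : ℝ, ∀ γ : ℕ → ℝ, (∀ k, γ k = 0 ∨ γ k = 1) →
      ∀ X : Matrix (Fin 2) (Fin 2) ℂ, X.PosSemidef →
      (ricc (Matrix.diagonal ![l1, l2]) C Q R X γ L).trace.re ≤ Lam ^ (2 * L) * X.trace.re + c := by
  induction L with
  | zero => exact ⟨0, fun γ hγ X hX => by simp [ricc]⟩
  | succ L ih =>
    obtain ⟨c, hc⟩ := ih
    refine ⟨Lam ^ 2 * c + Q.trace.re, fun γ hγ X hX => ?_⟩
    have h1 := trace_mono (riccStep_le (Matrix.diagonal ![l1, l2]) C Q R hR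
      (ricc_psd_s13 (Matrix.diagonal ![l1, l2]) C Q R hQ hR hX hγ L) (hγ L))
    rw [Matrix.trace_add, Complex.add_re, trace_conj l1 l2 Lam hl1 hl2] at h1
    rw [ricc]
    have h2 := mul_le_mul_of_nonneg_left (hc γ hγ X hX) (sq_nonneg Lam)
    rw [mul_add, 2 |> fun _ => pow_add Lam (2 * L) 2]
    linarith

lemma good_bd (h1 : l1 ≠ 0) (h2 : l2 ≠ 0) (hne : ∀ d : ℕ, l1 ^ d = l2 ^ d → q ∣ d)
    (hQ : Q.PosDef) (hR : R.PosDef) (i : Fin m) (hc0 : C i 0 ≠ 0) (hc1 : C i 1 ≠ 0)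
    {γ : ℕ → ℝ} (hg : ∀ k, γ k = 0 ∨ γ k = 1) (t d : ℕ) (ht : γ t = 1) (htd : γ (t + d) = 1)
    (hd : ¬ q ∣ d) (L : ℕ) (hL : t + d < L) (b : Fin 2 → ℂ) :
    Bd (Matrix.diagonal ![l1, l2]) C Q R γ L b := by
  set A := Matrix.diagonal ![l1, l2] with hA
  let f : ℕ → Fin 2 → ℂ := fun n => ![(star l1)⁻¹ ^ n * star (C i 0), (star l2)⁻¹ ^ n * star (C i 1)]
  have hs1 : star l1 ≠ 0 := by simpa using h1
  have hs2 : star l2 ≠ 0 := by simpa using h2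
  have hf0 : f 0 = Cᴴ *ᵥ (Pi.single i 1) := by
    ext j; fin_cases j <;> simp [f, Matrix.conjTranspose_apply]
  have hfs : ∀ n, Aᴴ *ᵥ f (n + 1) = f n := by
    intro n
    rw [hA, diagonal_conjTranspose]
    ext j; fin_cases j
    · simp only [f, mulVec_diagonal, pow_succ]
      simp
      have : (starRingEnd ℂ) l1 ≠ 0 := hs1
      field_simp
    · simp only [f, mulVec_diagonal, pow_succ]
      simp
      have : (starRingEnd ℂ) l2 ≠ 0 := hs2
      field_simp
  have hm : ∀ s, γ s = 1 → Bd A C Q R γ (s + 1) (f 1) := fun s hs =>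
    Bd_meas A C Q R hQ hR hg hs (Pi.single i 1) (by rw [hfs 0, hf0])
  have hprop : ∀ n, Bd A C Q R γ (t + 1 + n) (f (n + 1)) := by
    intro n
    induction n with
    | zero => exact hm t ht
    | succ n ih =>
      exact Bd_step A C Q R hQ hR hg (by rw [hfs]; exact ih)
  have hall : ∀ n, ∀ b, Bd A C Q R γ (t + d + 1 + n) b := by
    intro n
    induction n with
    | zero =>
      intro b
      have e1 := hm _ htd
      have e2 := hprop d
      rw [show t + 1 + d = t + d + 1 by ring] at e2
      obtain ⟨α, β, rfl⟩ := span_two (f 1) (f (d + 1)) (by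
        intro h0
        apply hd
        apply hne
        simp only [f, Matrix.cons_val_zero, Matrix.cons_val_one, pow_succ, pow_zero, one_mul] at h0
        have hc0' : star (C i 0) ≠ 0 := by simpa using hc0
        have hc1' : star (C i 1) ≠ 0 := by simpa using hc1
        have h3 : (star l1)⁻¹ * (star l2)⁻¹ * star (C i 0) * star (C i 1) *
          ((star l2)⁻¹ ^ d - (star l1)⁻¹ ^ d) = 0 := by linear_combination h0
        have h4 : (star l2)⁻¹ ^ d - (star l1)⁻¹ ^ d = 0 := by
          refine (mul_eq_zero.1 h3).resolve_left ?_
          exact mul_ne_zero (mul_ne_zero (mul_ne_zero (inv_ne_zero hs1) (inv_ne_zero hs2)) hc0') hc1'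
        have h5 := sub_eq_zero.1 h4
        rw [inv_pow, inv_pow, _root_.inv_inj, ← star_pow, ← star_pow] at h5
        exact (star_injective h5).symm) b
      exact Bd_add A C Q R hQ hR hg (Bd_smul A C Q R α e1) (Bd_smul A C Q R β e2)
    | succ n ih =>
      intro b
      exact Bd_step A C Q R hQ hR hg (ih _)
  have := hall (L - (t + d + 1)) b
  rwa [show t + d + 1 + (L - (t + d + 1)) = L by omega] at this

/-- all arrivals in a single residue class -/
def Bad (q L : ℕ) (γ : ℕ → ℝ) : Prop := ∃ c < q, ∀ i < L, γ i = 1 → i % q = c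

lemma not_bad {q L : ℕ} (hq : 0 < q) {γ : ℕ → ℝ} (h : ¬ Bad q L γ) :
    ∃ t d, γ t = 1 ∧ γ (t + d) = 1 ∧ ¬ q ∣ d ∧ t + d < L := by
  unfold Bad at h
  push Not at h
  obtain ⟨t0, ht0, hg0, -⟩ := h 0 hq
  obtain ⟨t1, ht1, hg1, hne⟩ := h (t0 % q) (Nat.mod_lt _ hq)
  rcases le_total t0 t1 with hle | hle
  · refine ⟨t0, t1 - t0, hg0, by rwa [Nat.add_sub_cancel' hle], fun hd => hne ?_, by omega⟩
    exact ((Nat.modEq_iff_dvd' hle).2 hd).symm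
  · refine ⟨t1, t0 - t1, hg1, by rwa [Nat.add_sub_cancel' hle], fun hd => hne ?_, by omega⟩
    exact ((Nat.modEq_iff_dvd' hle).2 hd)

lemma block_bound (hl1 : ‖l1‖ = Lam) (hl2 : ‖l2‖ = Lam) (hLam : 1 < Lam) (hq : 0 < q)
    (hne : ∀ d : ℕ, l1 ^ d = l2 ^ d → q ∣ d)
    (hQ : Q.PosDef) (hR : R.PosDef) (i : Fin m) (hc0 : C i 0 ≠ 0) (hc1 : C i 1 ≠ 0) (L : ℕ) :
    ∃ K : ℝ, 0 ≤ K ∧ ∀ γ : ℕ → ℝ, (∀ k, γ k = 0 ∨ γ k = 1) →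
      ∀ X : Matrix (Fin 2) (Fin 2) ℂ, X.PosSemidef →
      (¬ Bad q L γ → (ricc (Matrix.diagonal ![l1, l2]) C Q R X γ L).trace.re ≤ K) ∧
      (ricc (Matrix.diagonal ![l1, l2]) C Q R X γ L).trace.re ≤ K + Lam ^ (2 * L) * X.trace.re := by
  classical
  obtain ⟨c, hc⟩ := trace_growth l1 l2 Lam C Q R hl1 hl2 hQ hR L
  have h1 : l1 ≠ 0 := by rw [← norm_ne_zero_iff, hl1]; linarith
  have h2 : l2 ≠ 0 := by rw [← norm_ne_zero_iff, hl2]; linarith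
  have key : ∀ S : Finset ℕ, ∃ M : ℝ, 0 ≤ M ∧ (¬ Bad q L (fun i => if i ∈ S then 1 else 0) →
      ∀ X : Matrix (Fin 2) (Fin 2) ℂ, X.PosSemidef →
      (ricc (Matrix.diagonal ![l1, l2]) C Q R X
        (fun i => if i ∈ S then 1 else 0) L).trace.re ≤ M) := by
    intro S
    by_cases hb : Bad q L (fun i => if i ∈ S then 1 else 0)
    · exact ⟨0, le_rfl, fun h => absurd hb h⟩
    · obtain ⟨t, d, ht, htd, hd, hL⟩ := not_bad hq hb
      have hg : ∀ k, (fun i => if i ∈ S then (1:ℝ) else 0) k = 0 ∨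
        (fun i => if i ∈ S then (1:ℝ) else 0) k = 1 := by
        intro k; by_cases hk : k ∈ S <;> simp [hk]
      have hB := good_bd l1 l2 q C Q R h1 h2 hne hQ hR i hc0 hc1 hg t d ht htd hd L hL
      obtain ⟨M0, hM0⟩ := hB (Pi.single 0 1)
      obtain ⟨M1, hM1⟩ := hB (Pi.single 1 1)
      refine ⟨max 0 (M0 + M1), le_max_left _ _, fun _ X hX => le_trans ?_ (le_max_right _ _)⟩
      rw [trace_qf]
      exact add_le_add (hM0 X hX) (hM1 X hX)
  choose M hM0 hM using key
  have hsum : 0 ≤ ∑ S ∈ (Finset.range L).powerset, M S := Finset.sum_nonneg fun S _ => hM0 S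
  refine ⟨|c| + ∑ S ∈ (Finset.range L).powerset, M S, by positivity, fun γ hγ X hX => ⟨?_, ?_⟩⟩
  · intro hb
    set S := (Finset.range L).filter (fun i => γ i = 1) with hS
    have hag : ∀ j < L, γ j = (fun i => if i ∈ S then (1:ℝ) else 0) j := by
      intro j hj
      rcases hγ j with h | h <;> simp [hS, hj, h]
    rw [ricc_congr _ _ _ _ _ _ _ _ hag]
    have hb' : ¬ Bad q L (fun i => if i ∈ S then (1:ℝ) else 0) := by
      rintro ⟨c, hcq, hc⟩
      exact hb ⟨c, hcq, fun i hi h => hc i hi (by rw [← hag i hi]; exact h)⟩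
    refine (hM S hb' X hX).trans ?_
    have : M S ≤ ∑ S ∈ (Finset.range L).powerset, M S :=
      Finset.single_le_sum (f := M) (fun S _ => hM0 S)
        (Finset.mem_powerset.2 (Finset.filter_subset _ _))
    linarith [abs_nonneg c]
  · have := hc γ hγ X hX
    linarith [le_abs_self c]

end Two

section Prob
variable {Ω : Type} [MeasurableSpace Ω]

/-- `f` depends only on the arrivals with index in `S` -/
def DepOn (γ : ℕ → Ω → ℝ) (S : Finset ℕ) {E : Type} (f : Ω → E) : Prop :=
  ∃ g : (S → Bool) → E, ∀ ω, f ω = g (fun i => decide (γ i ω = 1))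

lemma DepOn.of_congr (γ : ℕ → Ω → ℝ) (h01 : ∀ k ω, γ k ω = 0 ∨ γ k ω = 1) (S : Finset ℕ) {E : Type}
    (G : (ℕ → ℝ) → E) (hG : ∀ g g' : ℕ → ℝ, (∀ i ∈ S, g i = g' i) → G g = G g') :
    DepOn γ S (fun ω => G (fun i => γ i ω)) := by
  classical
  refine ⟨fun t => G (fun i => if h : i ∈ S then (if t ⟨i, h⟩ = true then 1 else 0) else 0), ?_⟩
  intro ω
  apply hG
  intro i hi
  rcases h01 i ω with h | h <;> simp [hi, h]

lemma meas_dec {γ : ℕ → Ω → ℝ} (hmeas : ∀ k, Measurable (γ k)) (i : ℕ) :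
    Measurable (fun ω => decide (γ i ω = 1)) := by
  have h2 : Measurable (fun x : ℝ => decide (x = 1)) := by
    apply measurable_to_bool
    have : (fun x : ℝ => decide (x = 1)) ⁻¹' {true} = {1} := by ext; simp
    rw [this]
    exact measurableSet_singleton _
  exact h2.comp (hmeas i)

lemma DepOn.measurable {γ : ℕ → Ω → ℝ} (hmeas : ∀ k, Measurable (γ k)) {S : Finset ℕ} {E : Type}
    [MeasurableSpace E] {f : Ω → E} (h : DepOn γ S f) : Measurable f := by
  obtain ⟨g, hg⟩ := h
  have h1 : Measurable (fun ω => (fun i : S => decide (γ i ω = 1))) :=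
    measurable_pi_lambda _ (fun i => meas_dec hmeas i)
  have h2 : Measurable g := measurable_of_finite g
  have : f = g ∘ (fun ω => (fun i : S => decide (γ i ω = 1))) := funext hg
  rw [this]
  exact h2.comp h1

lemma DepOn.integrable {γ : ℕ → Ω → ℝ} (hmeas : ∀ k, Measurable (γ k)) {S : Finset ℕ} {E : Type}
    [NormedAddCommGroup E] [MeasurableSpace E] [BorelSpace E] [SecondCountableTopology E]
    (μ : Measure Ω) [IsProbabilityMeasure μ]
    {f : Ω → E} (h : DepOn γ S f) : Integrable f μ := by
  have hm := h.measurable hmeas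
  obtain ⟨g, hg⟩ := h
  refine Integrable.of_bound hm.aestronglyMeasurable (∑ t, ‖g t‖) (ae_of_all _ fun ω => ?_)
  rw [hg]
  exact Finset.single_le_sum (f := fun t => ‖g t‖) (fun t _ => norm_nonneg _) (Finset.mem_univ _)

lemma DepOn.integral_mul {γ : ℕ → Ω → ℝ} (hmeas : ∀ k, Measurable (γ k))
    (μ : Measure Ω) [IsProbabilityMeasure μ]
    (hind : iIndepFun (m := fun _ => inferInstance) γ μ) {S T : Finset ℕ} (hST : Disjoint S T)
    {f g : Ω → ℝ} (hf : DepOn γ S f) (hg : DepOn γ T g) :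
    ∫ ω, f ω * g ω ∂μ = (∫ ω, f ω ∂μ) * ∫ ω, g ω ∂μ := by
  have hfm := hf.measurable hmeas
  have hgm := hg.measurable hmeas
  obtain ⟨F, hF⟩ := hf
  obtain ⟨G, hG⟩ := hg
  have h2 : Measurable (fun x : ℝ => decide (x = 1)) := by
    apply measurable_to_bool
    have : (fun x : ℝ => decide (x = 1)) ⁻¹' {true} = {1} := by ext; simp
    rw [this]
    exact measurableSet_singleton _
  have h3 := hind.comp (fun _ x => decide (x = 1)) (fun _ => h2)
  have h4 := h3.indepFun_finset S T hST (fun i => meas_dec hmeas i)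
  have h5 := h4.comp (measurable_of_finite F) (measurable_of_finite G)
  have h6 : IndepFun f g μ := by
    have e1 : f = F ∘ (fun ω => (fun i : S => decide (γ i ω = 1))) := funext hF
    have e2 : g = G ∘ (fun ω => (fun i : T => decide (γ i ω = 1))) := funext hG
    rw [e1, e2]
    exact h5
  exact h6.integral_fun_mul_eq_mul_integral hfm.aestronglyMeasurable hgm.aestronglyMeasurable

lemma noarr {γ : ℕ → Ω → ℝ} (μ : Measure Ω) [IsProbabilityMeasure μ]
    (hind : iIndepFun (m := fun _ => inferInstance) γ μ) (s : ℝ)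
    (hs : ∀ k, μ.real {ω | γ k ω ≠ 1} = s) (S : Finset ℕ) :
    μ.real {ω | ∀ i ∈ S, γ i ω ≠ 1} = s ^ S.card := by
  have h := hind.measure_inter_preimage_eq_mul S (sets := fun _ => {1}ᶜ)
    (fun i _ => (measurableSet_singleton _).compl)
  have e : {ω | ∀ i ∈ S, γ i ω ≠ 1} = ⋂ i ∈ S, γ i ⁻¹' {1}ᶜ := by
    ext; simp
  have hs' : ∀ i ∈ S, (μ (γ i ⁻¹' {1}ᶜ)).toReal = s := fun i _ => hs i
  rw [e, measureReal_def, h, ENNReal.toReal_prod, Finset.prod_congr rfl hs', Finset.prod_const]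

lemma card_class (q N c : ℕ) (hc : c < q) :
    ((Finset.range (q * N)).filter (fun i => i % q ≠ c)).card = (q - 1) * N := by
  have h1 := Finset.card_filter_add_card_filter_not (s := Finset.range (q * N)) (fun i => i % q = c)
  have h2 : ((Finset.range (q * N)).filter (fun i => i % q = c)).card = N := by
    have : (Finset.range (q * N)).filter (fun i => i % q = c)
        = (Finset.range N).image (fun j => q * j + c) := by
      ext i
      simp only [Finset.mem_filter, Finset.mem_range, Finset.mem_image]
      constructor
      · rintro ⟨h, h'⟩
        exact ⟨i / q, Nat.div_lt_of_lt_mul h, by rw [← h']; exact Nat.div_add_mod i q⟩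
      · rintro ⟨j, hj, rfl⟩
        refine ⟨?_, by simp [Nat.mod_eq_of_lt hc]⟩
        calc q * j + c < q * (j + 1) := by rw [mul_add, mul_one]; omega
          _ ≤ q * N := Nat.mul_le_mul_left _ hj
    rw [this, Finset.card_image_of_injective, Finset.card_range]
    intro a b hab
    simp only [add_left_inj] at hab
    exact Nat.eq_of_mul_eq_mul_left (by omega) hab
  rw [h2, Finset.card_range] at h1
  have h3 : q * N = (q - 1) * N + N := by
    obtain ⟨r, rfl⟩ : ∃ r, q = r + 1 := ⟨q - 1, by omega⟩
    simp; ring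
  simp only [ne_eq]
  omega

lemma bad_prob {γ : ℕ → Ω → ℝ} (μ : Measure Ω) [IsProbabilityMeasure μ]
    (hind : iIndepFun (m := fun _ => inferInstance) γ μ) (s : ℝ)
    (hs : ∀ k, μ.real {ω | γ k ω ≠ 1} = s) (q N k : ℕ) :
    μ.real {ω | Bad q (q * N) (fun i => γ (k + i) ω)} ≤ q * s ^ ((q - 1) * N) := by
  classical
  let T : ℕ → Finset ℕ := fun c =>
    ((Finset.range (q * N)).filter (fun i => i % q ≠ c)).map (addLeftEmbedding k)
  have hsub : {ω | Bad q (q * N) (fun i => γ (k + i) ω)} ⊆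
      ⋃ c ∈ Finset.range q, {ω | ∀ i ∈ T c, γ i ω ≠ 1} := by
    rintro ω ⟨c, hc, h⟩
    simp only [Set.mem_iUnion, Finset.mem_range, Set.mem_ofPred_eq]
    refine ⟨c, hc, ?_⟩
    intro i hi hg
    simp only [T, Finset.mem_map, Finset.mem_filter, Finset.mem_range, addLeftEmbedding_apply] at hi
    obtain ⟨j, ⟨hj, hjc⟩, rfl⟩ := hi
    exact hjc (h j hj hg)
  refine (measureReal_mono hsub (measure_ne_top _ _)).trans ((measureReal_biUnion_finset_le _ _).trans ?_)
  have : ∀ c ∈ Finset.range q, μ.real {ω | ∀ i ∈ T c, γ i ω ≠ 1} = s ^ ((q - 1) * N) := by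
    intro c hc
    rw [noarr μ hind s hs, Finset.card_map, card_class q N c (Finset.mem_range.1 hc)]
  rw [Finset.sum_congr rfl this]
  simp

lemma dot_matExp {ι : Type} [Fintype ι] (μ : Measure Ω) (P : Ω → Matrix ι ι ℂ)
    (hi : ∀ i j, Integrable (fun ω => P ω i j) μ) (a : ι → ℂ) :
    star a ⬝ᵥ (matExp μ P *ᵥ a) = ∫ ω, star a ⬝ᵥ (P ω *ᵥ a) ∂μ ∧
      Integrable (fun ω => star a ⬝ᵥ (P ω *ᵥ a)) μ := by
  have hint : ∀ i j, Integrable (fun ω => star (a i) * (P ω i j * a j)) μ := fun i j =>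
    ((hi i j).mul_const _).const_mul _
  simp only [dotProduct, mulVec, matExp, Matrix.of_apply, Finset.mul_sum, Pi.star_apply]
  constructor
  · rw [integral_finsetSum _ (fun i _ => integrable_finsetSum _ (fun j _ => hint i j))]
    refine Finset.sum_congr rfl fun i _ => ?_
    rw [integral_finsetSum _ (fun j _ => hint i j)]
    refine Finset.sum_congr rfl fun j _ => ?_
    rw [integral_const_mul, integral_mul_const]
  · exact integrable_finsetSum _ (fun i _ => integrable_finsetSum _ (fun j _ => hint i j))

lemma qf_matExp {ι : Type} [Fintype ι] (μ : Measure Ω) (P : Ω → Matrix ι ι ℂ)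
    (hi : ∀ i j, Integrable (fun ω => P ω i j) μ) (a : ι → ℂ) :
    qf (matExp μ P) a = ∫ ω, qf (P ω) a ∂μ ∧ Integrable (fun ω => qf (P ω) a) μ := by
  obtain ⟨h1, h2⟩ := dot_matExp μ P hi a
  unfold qf
  rw [h1]
  exact ⟨(Complex.reCLM.integral_comp_comm h2).symm, Complex.reCLM.integrable_comp h2⟩

lemma psd_matExp {ι : Type} [Fintype ι] (μ : Measure Ω) (P : Ω → Matrix ι ι ℂ)
    (hi : ∀ i j, Integrable (fun ω => P ω i j) μ) (hP : ∀ ω, (P ω).PosSemidef) :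
    (matExp μ P).PosSemidef := by
  refine PosSemidef.of_dotProduct_mulVec_nonneg ?_ ?_
  · ext i j
    simp only [conjTranspose_apply, matExp, Matrix.of_apply]
    have := integral_conj (μ := μ) (f := fun ω => P ω j i)
    refine (this.symm).trans ?_
    congr 1
    ext ω
    exact (hP ω).isHermitian.apply i j
  · intro x
    rw [(dot_matExp μ P hi x).1]
    exact integral_nonneg fun ω => (hP ω).dotProduct_mulVec_nonneg x

end Prob

section Main
variable {m : ℕ} {Ω : Type} [MeasurableSpace Ω]

lemma ricc_dep {ι κ : Type} [Fintype ι] [Fintype κ] [DecidableEq ι] [DecidableEq κ]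
    (A : Matrix ι ι ℂ) (C : Matrix κ ι ℂ) (Q : Matrix ι ι ℂ) (R : Matrix κ κ ℂ) (S0 : Matrix ι ι ℂ)
    (γ : ℕ → Ω → ℝ) (h01 : ∀ k ω, γ k ω = 0 ∨ γ k ω = 1) (k : ℕ) {E : Type}
    (F : Matrix ι ι ℂ → E) :
    DepOn γ (Finset.range k) (fun ω => F (ricc A C Q R S0 (fun i => γ i ω) k)) :=
  DepOn.of_congr γ h01 (Finset.range k) (fun g => F (ricc A C Q R S0 g k)) (fun g g' h => by
    rw [ricc_congr A C Q R S0 g g' k (fun i hi => h i (Finset.mem_range.2 hi))])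

lemma upper_main (l1 l2 : ℂ) (Lam : ℝ) (q : ℕ)
    (C : Matrix (Fin m) (Fin 2) ℂ) (Q : Matrix (Fin 2) (Fin 2) ℂ) (R : Matrix (Fin m) (Fin m) ℂ)
    (hl1 : ‖l1‖ = Lam) (hl2 : ‖l2‖ = Lam) (hLam : 1 < Lam) (hq : 0 < q)
    (hne : ∀ d : ℕ, l1 ^ d = l2 ^ d → q ∣ d)
    (hQ : Q.PosDef) (hR : R.PosDef) (i0 : Fin m) (hc0 : C i0 0 ≠ 0) (hc1 : C i0 1 ≠ 0)
    (μ : Measure Ω) [IsProbabilityMeasure μ]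
    (γ : ℕ → Ω → ℝ)
    (hmeas : ∀ k, Measurable (γ k))
    (hind : iIndepFun (m := fun _ => inferInstance) γ μ)
    (h01 : ∀ k ω, γ k ω = 0 ∨ γ k ω = 1) (s : ℝ) (hs0 : 0 ≤ s)
    (hs : ∀ k, μ.real {ω | γ k ω ≠ 1} = s) (hx : Lam ^ (2 * q) * s ^ (q - 1) < 1)
    (S0 : Matrix (Fin 2) (Fin 2) ℂ) (hS0 : S0.PosSemidef) :
    EBounded μ (fun k ω =>
          ricc (Matrix.diagonal ![l1, l2]) C Q R S0 (fun i => γ i ω) k) := by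
  classical
  set A := Matrix.diagonal ![l1, l2] with hA
  set P : ℕ → Ω → Matrix (Fin 2) (Fin 2) ℂ := fun k ω => ricc A C Q R S0 (fun i => γ i ω) k with hP
  have hpsd : ∀ k ω, (P k ω).PosSemidef := fun k ω =>
    ricc_psd_s13 A C Q R hQ hR hS0 (fun i => h01 i ω) k
  have hint : ∀ k i j, Integrable (fun ω => P k ω i j) μ := fun k i j =>
    (ricc_dep A C Q R S0 γ h01 k (fun X => X i j)).integrable hmeas μ
  have htdep : ∀ k, DepOn γ (Finset.range k) (fun ω => (P k ω).trace.re) := fun k =>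
    ricc_dep A C Q R S0 γ h01 k (fun X => X.trace.re)
  have htint : ∀ k, Integrable (fun ω => (P k ω).trace.re) μ := fun k =>
    (htdep k).integrable hmeas μ
  set e : ℕ → ℝ := fun k => ∫ ω, (P k ω).trace.re ∂μ with he
  have he0 : ∀ k, 0 ≤ e k := fun k => integral_nonneg fun ω => trace_nn (hpsd k ω)
  have hqpos : (0:ℝ) < q := by exact_mod_cast hq
  have hLam0 : 0 < Lam := by linarith
  -- choose block length
  obtain ⟨N, hN⟩ := exists_pow_lt_of_lt_one (show (0:ℝ) < 1 / (2 * q) by positivity) hx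
  have hN0 : N ≠ 0 := by
    rintro rfl
    rw [pow_zero, lt_div_iff₀ (by positivity)] at hN
    have : (1:ℝ) ≤ q := by exact_mod_cast hq
    linarith
  set L := q * N with hL
  have hLpos : 0 < L := Nat.mul_pos hq (Nat.pos_of_ne_zero hN0)
  set ρ : ℝ := Lam ^ (2 * L) * (q * s ^ ((q - 1) * N)) with hρ
  have hρ0 : 0 ≤ ρ := by positivity
  have hρ1 : ρ ≤ 1 / 2 := by
    have : ρ = q * (Lam ^ (2 * q) * s ^ (q - 1)) ^ N := by
      rw [hρ, hL, mul_pow, ← pow_mul, ← pow_mul, ← mul_assoc 2 q N]; ring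
    rw [this]
    calc (q:ℝ) * (Lam ^ (2 * q) * s ^ (q - 1)) ^ N ≤ q * (1 / (2 * q)) := by gcongr
      _ = 1 / 2 := by field_simp
  obtain ⟨K, hK0, hK⟩ := block_bound l1 l2 Lam q C Q R hl1 hl2 hLam hq hne hQ hR i0 hc0 hc1 L
  have hrec : ∀ k, e (k + L) ≤ K + ρ * e k := by
    intro k
    set ind : Ω → ℝ := fun ω => if Bad q L (fun i => γ (k + i) ω) then 1 else 0 with hind'
    let T : Finset ℕ := Finset.Ico k (k + L)
    have hcongr : ∀ g g' : ℕ → ℝ, (∀ i ∈ T, g i = g' i) →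
        (Bad q L (fun i => g (k + i)) ↔ Bad q L (fun i => g' (k + i))) := by
      intro g g' h
      unfold Bad
      refine exists_congr fun c => and_congr Iff.rfl (forall_congr' fun i => forall_congr' fun hi => ?_)
      change (g (k + i) = 1 → i % q = c) ↔ (g' (k + i) = 1 → i % q = c)
      rw [h (k + i) (by simp [T, hi])]
    have hinddep : DepOn γ T ind :=
      DepOn.of_congr γ h01 T (fun g => if Bad q L (fun i => g (k + i)) then (1:ℝ) else 0)
        (fun g g' h => by simp only [hcongr g g' h])
    have hsetdep : DepOn γ T (fun ω => Bad q L (fun i => γ (k + i) ω)) :=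
      DepOn.of_congr γ h01 T (fun g => Bad q L (fun i => g (k + i)))
        (fun g g' h => propext (hcongr g g' h))
    have hset : MeasurableSet {ω | Bad q L (fun i => γ (k + i) ω)} :=
      measurableSet_setOfPred.2 (hsetdep.measurable hmeas)
    have hdisj : Disjoint T (Finset.range k) := by
      rw [Finset.disjoint_left]; intro i hi; simp [T] at hi ⊢; omega
    have hprod := DepOn.integral_mul hmeas μ hind hdisj hinddep (htdep k)
    have hprodint : Integrable (fun ω => ind ω * (P k ω).trace.re) μ := by
      refine (htint k).bdd_mul (c := 1) (hinddep.measurable hmeas).aestronglyMeasurable ?_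
      refine ae_of_all _ fun ω => ?_
      simp only [hind']
      split_ifs <;> simp
    have hindint : ∫ ω, ind ω ∂μ ≤ q * s ^ ((q - 1) * N) := by
      have : ind = Set.indicator {ω | Bad q L (fun i => γ (k + i) ω)} 1 := by
        ext ω; simp [hind', Set.indicator]
      rw [this, integral_indicator_one hset]
      exact bad_prob μ hind s hs q N k
    have hpt : ∀ ω, (P (k + L) ω).trace.re ≤ K + Lam ^ (2 * L) * (ind ω * (P k ω).trace.re) := by
      intro ω
      simp only [hP]
      rw [ricc_add]
      obtain ⟨h1, h2⟩ := hK (fun i => γ (k + i) ω) (fun i => h01 _ ω) _ (hpsd k ω)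
      by_cases hb : Bad q L (fun i => γ (k + i) ω)
      · simp only [hind', hb, if_true, one_mul]; exact h2
      · simp only [hind', hb, if_false, zero_mul, mul_zero, add_zero]; exact h1 hb
    calc e (k + L) ≤ ∫ ω, (K + Lam ^ (2 * L) * (ind ω * (P k ω).trace.re)) ∂μ :=
          integral_mono (htint _) ((integrable_const _).add (hprodint.const_mul _)) hpt
      _ = K + Lam ^ (2 * L) * ((∫ ω, ind ω ∂μ) * e k) := by
          rw [integral_add (integrable_const _) (hprodint.const_mul _), integral_const_mul, hprod]
          simp only [integral_const, probReal_univ, one_smul, he]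
      _ ≤ K + Lam ^ (2 * L) * ((q * s ^ ((q - 1) * N)) * e k) := by
          have := he0 k
          gcongr
      _ = K + ρ * e k := by rw [hρ]; ring
  have hbound : ∀ k, e k ≤ 2 * K + ∑ i ∈ Finset.range L, e i := by
    intro k
    have hsum : 0 ≤ ∑ i ∈ Finset.range L, e i := Finset.sum_nonneg fun i _ => he0 i
    induction k using Nat.strong_induction_on with
    | _ k ih =>
      by_cases hk : k < L
      · have := Finset.single_le_sum (f := e) (fun i _ => he0 i) (Finset.mem_range.2 hk)
        linarith
      · have h1 := hrec (k - L)
        rw [Nat.sub_add_cancel (by omega)] at h1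
        have h2 := ih (k - L) (by omega)
        have h3 : ρ * e (k - L) ≤ 1 / 2 * e (k - L) :=
          mul_le_mul_of_nonneg_right hρ1 (he0 _)
        linarith
  refine ⟨hint, _, ?_, fun k => psd_trace (psd_matExp μ (P k) (hint k) (hpsd k))
    (2 * K + ∑ i ∈ Finset.range L, e i) ?_⟩
  · rw [IsHermitian, conjTranspose_smul, conjTranspose_one]
    simp
  · refine le_trans (le_of_eq ?_) (hbound k)
    rw [trace_qf]
    obtain ⟨a1, a2⟩ := qf_matExp μ (P k) (hint k) (Pi.single 0 1)
    obtain ⟨b1, b2⟩ := qf_matExp μ (P k) (hint k) (Pi.single 1 1)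
    rw [a1, b1, ← integral_add a2 b2]
    simp only [he, trace_qf]

lemma lower_main (l1 l2 : ℂ) (Lam : ℝ) (q : ℕ)
    (C : Matrix (Fin m) (Fin 2) ℂ) (Q : Matrix (Fin 2) (Fin 2) ℂ) (R : Matrix (Fin m) (Fin m) ℂ)
    (hl1 : ‖l1‖ = Lam) (hq : 0 < q)
    (heq : l1 ^ q = l2 ^ q)
    (hQ : Q.PosDef) (hR : R.PosDef) (a : Fin 2 → ℂ) (ha : a ≠ 0) (hCa : C *ᵥ a = 0)
    (μ : Measure Ω) [IsProbabilityMeasure μ]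
    (γ : ℕ → Ω → ℝ)
    (hmeas : ∀ k, Measurable (γ k))
    (hind : iIndepFun (m := fun _ => inferInstance) γ μ)
    (h01 : ∀ k ω, γ k ω = 0 ∨ γ k ω = 1) (s : ℝ)
    (hs : ∀ k, μ.real {ω | γ k ω ≠ 1} = s) (hx : 1 < Lam ^ (2 * q) * s ^ (q - 1)) :
    ¬ EBounded μ (fun k ω =>
          ricc (Matrix.diagonal ![l1, l2]) C Q R (vecMulVec a (star a)) (fun i => γ i ω) k) := by
  classical
  set A := Matrix.diagonal ![l1, l2] with hA
  set P : ℕ → Ω → Matrix (Fin 2) (Fin 2) ℂ :=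
    fun k ω => ricc A C Q R (vecMulVec a (star a)) (fun i => γ i ω) k with hP
  rintro ⟨hint, M, -, hM⟩
  have hpsd : ∀ k ω, (P k ω).PosSemidef := fun k ω =>
    ricc_psd_s13 A C Q R hQ hR (posSemidef_vecMulVec_self_star a) (fun i => h01 i ω) k
  have hpow : ∀ n, A ^ (q * n) *ᵥ a = (l1 ^ (q * n)) • a := by
    intro n
    rw [hA, diagonal_pow]
    ext j
    fin_cases j
    · simp [mulVec_diagonal]
    · simp [mulVec_diagonal, pow_mul, heq]
  set w : ℝ := qf (vecMulVec a (star a)) a with hw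
  have hwval : vecMulVec a (star a) *ᵥ a = (star a ⬝ᵥ a) • a := by
    ext j; simp [vecMulVec_mulVec, mul_comm]
  have hw0 : 0 < w := by
    have h1 : 0 < star a ⬝ᵥ a := dotProduct_star_self_pos_iff.2 ha
    have h2 : 0 < star a ⬝ᵥ (vecMulVec a (star a) *ᵥ a) := by
      rw [hwval, dotProduct_smul, smul_eq_mul]; exact mul_pos h1 h1
    exact (Complex.lt_def.1 h2).1
  have hlow : ∀ n, (Lam ^ (2 * q) * s ^ (q - 1)) ^ n * w ≤ qf M a := by
    intro n
    let T : Finset ℕ := (Finset.range (q * n)).filter (fun i => i % q ≠ 0)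
    set E : Set Ω := {ω | ∀ i ∈ T, γ i ω ≠ 1} with hE
    have hEm : MeasurableSet E := by
      have : E = ⋂ i ∈ T, γ i ⁻¹' {1}ᶜ := by ext; simp [hE]
      rw [this]
      exact Finset.measurableSet_biInter _ fun i _ => hmeas i (measurableSet_singleton _).compl
    have hEp : μ.real E = s ^ ((q - 1) * n) := by
      rw [hE, noarr μ hind s hs, card_class q n 0 hq]
    obtain ⟨e1, e2⟩ := qf_matExp μ (P (q * n)) (hint (q * n)) a
    have hpt : ∀ ω, E.indicator (fun _ => Lam ^ (2 * (q * n)) * w) ω ≤ qf (P (q * n) ω) a := by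
      intro ω
      by_cases hω : ω ∈ E
      · rw [Set.indicator_of_mem hω]
        have h1 := ricc_lower A C Q R hQ hR a (fun i => h01 i ω) (q * n) (by
          intro t ht hg
          have : t % q = 0 := by
            by_contra hne
            exact hω t (by simp [T, ht, hne]) hg
          obtain ⟨r, rfl⟩ := Nat.dvd_of_mod_eq_zero this
          rw [hpow, mulVec_smul, hCa, smul_zero])
        refine le_trans (le_of_eq ?_) (qf_mono h1 a)
        rw [hpow]
        have : vecMulVec (l1 ^ (q * n) • a) (star (l1 ^ (q * n) • a))
            = ((Lam ^ (2 * (q * n)) : ℝ) : ℂ) • vecMulVec a (star a) := by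
          have hn : l1 ^ (q * n) * star (l1 ^ (q * n)) = ((Lam ^ (2 * (q * n)) : ℝ) : ℂ) := by
            have := Complex.mul_conj' (l1 ^ (q * n))
            rw [norm_pow, hl1] at this
            rw [mul_comm 2, pow_mul Lam, Complex.ofReal_pow]
            exact this
          rw [← hn]
          ext i j
          simp [vecMulVec_apply]; ring
        rw [this, hw]
        unfold qf
        rw [smul_mulVec, dotProduct_smul, smul_eq_mul, Complex.re_ofReal_mul]
      · rw [Set.indicator_of_notMem hω]
        exact qf_nonneg (hpsd _ ω) a
    calc (Lam ^ (2 * q) * s ^ (q - 1)) ^ n * w = ∫ ω, E.indicator (fun _ => Lam ^ (2 * (q * n)) * w) ω ∂μ := by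
          rw [integral_indicator_const _ hEm, hEp, smul_eq_mul, mul_pow, ← pow_mul, ← pow_mul, mul_assoc 2 q n]
          ring
      _ ≤ ∫ ω, qf (P (q * n) ω) a ∂μ :=
          integral_mono ((integrable_const _).indicator hEm) e2 hpt
      _ = qf (matExp μ (P (q * n))) a := e1.symm
      _ ≤ qf M a := qf_mono (hM (q * n)) a
  obtain ⟨n, hn⟩ := pow_unbounded_of_one_lt (qf M a / w) hx
  rw [div_lt_iff₀ hw0] at hn
  exact absurd (hlow n) (not_le.2 hn)

end Main

/-- second order degenerate system, rational phase.  If `λ₂ = λ₁ e^{iφ}` with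
`|λ₁| = |λ₂| = Λ > 1`, `φ/(2π) = r/q` irreducible, and `rank C = 1`, then the critical value is
`p_c = 1 − Λ^{−2q/(q−1)}`. -/
theorem stmt13 {m : ℕ} (l1 l2 : ℂ) (Lam : ℝ) (φ : ℝ) (r q : ℕ)
    (hl1 : ‖l1‖ = Lam) (hl2 : ‖l2‖ = Lam) (hLam : 1 < Lam)
    (hphase : l2 = l1 * Complex.exp (φ * Complex.I))
    (hφ : φ ∈ Set.Ioo (0 : ℝ) (2 * Real.pi))
    (hr : 0 < r) (hrq : r < q) (hcop : Nat.Coprime r q)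
    (hrat : φ / (2 * Real.pi) = (r : ℝ) / q)
    (C : Matrix (Fin m) (Fin 2) ℂ) (hrank : C.rank = 1)
    (hdet : Detectable (Matrix.diagonal ![l1, l2]) C)
    (Q : Matrix (Fin 2) (Fin 2) ℂ) (R : Matrix (Fin m) (Fin m) ℂ)
    (hQ : Q.PosDef) (hR : R.PosDef)
    {Ω : Type} [MeasurableSpace Ω] (μ : Measure Ω) [IsProbabilityMeasure μ]
    (γ : ℕ → Ω → ℝ) (p : ℝ)
    (hmeas : ∀ k, Measurable (γ k))
    (hind : iIndepFun (m := fun _ => inferInstance) γ μ)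
    (h01 : ∀ k ω, γ k ω = 0 ∨ γ k ω = 1)
    (hber : ∀ k, μ {ω | γ k ω = 1} = ENNReal.ofReal p) :
    (1 - Lam ^ (-(2 * (q : ℝ) / ((q : ℝ) - 1))) < p →
      ∀ S0 : Matrix (Fin 2) (Fin 2) ℂ, S0.PosSemidef →
        EBounded μ (fun k ω =>
          ricc (Matrix.diagonal ![l1, l2]) C Q R S0 (fun i => γ i ω) k)) ∧
    (p < 1 - Lam ^ (-(2 * (q : ℝ) / ((q : ℝ) - 1))) →
      ∃ S0 : Matrix (Fin 2) (Fin 2) ℂ, S0.PosSemidef ∧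
        ¬ EBounded μ (fun k ω =>
          ricc (Matrix.diagonal ![l1, l2]) C Q R S0 (fun i => γ i ω) k)) := by
  have hq2 : 2 ≤ q := by omega
  have hq0 : 0 < q := by omega
  have hLam0 : 0 < Lam := by linarith
  have hl10 : l1 ≠ 0 := by rw [← norm_ne_zero_iff, hl1]; linarith
  have hqR : (q : ℝ) ≠ 0 := by positivity
  -- the phase is a primitive root of unity
  have hprim : IsPrimitiveRoot (Complex.exp (φ * Complex.I)) q := by
    have h := Complex.isPrimitiveRoot_exp_of_coprime r q (by omega) hcop
    have e : (φ : ℂ) * Complex.I = 2 * Real.pi * Complex.I * (r / q) := by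
      have : φ = 2 * Real.pi * (r / q) := by
        rw [← hrat]; field_simp
      rw [this]; push_cast; ring
    rw [e]; exact h
  have heq : l1 ^ q = l2 ^ q := by rw [hphase, mul_pow, hprim.pow_eq_one, mul_one]
  have hne : ∀ d : ℕ, l1 ^ d = l2 ^ d → q ∣ d := by
    intro d hd
    rw [hphase, mul_pow] at hd
    refine hprim.dvd_of_pow_eq_one d ?_
    have h0 : l1 ^ d ≠ 0 := pow_ne_zero _ hl10
    exact mul_left_cancel₀ h0 (by rw [mul_one]; exact hd.symm)
  -- kernel vector
  obtain ⟨a, ha, hCa⟩ : ∃ a : Fin 2 → ℂ, a ≠ 0 ∧ C *ᵥ a = 0 := by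
    by_contra hcon
    push Not at hcon
    have hinj : Function.Injective C.mulVecLin := by
      rw [← LinearMap.ker_eq_bot, LinearMap.ker_eq_bot']
      intro x hx
      by_contra hx0
      exact hcon x hx0 hx
    have := LinearMap.finrank_range_of_inj hinj
    have h2 : C.rank = 2 := by
      rw [Matrix.rank, this]; simp
    omega
  have hcol : ∀ j : Fin 2, C *ᵥ (Pi.single j 1) ≠ 0 := by
    intro j hj
    have hz : 1 ≤ ‖(![l1, l2] : Fin 2 → ℂ) j‖ := by
      fin_cases j
      · simp [hl1, hLam.le]
      · simp [hl2, hLam.le]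
    have h := hdet _ hz
    set F := Matrix.fromRows (Matrix.diagonal ![l1, l2] - (![l1, l2] : Fin 2 → ℂ) j • (1 : Matrix (Fin 2) (Fin 2) ℂ)) C with hF
    have hk : F.mulVecLin (Pi.single j 1) = 0 := by
      rw [Matrix.mulVecLin_apply, hF, Matrix.fromRows_mulVec, hj]
      have : (Matrix.diagonal ![l1, l2] - (![l1, l2] : Fin 2 → ℂ) j • (1 : Matrix (Fin 2) (Fin 2) ℂ)) *ᵥ (Pi.single j 1) = 0 := by
        ext i
        fin_cases j <;> fin_cases i <;> simp [sub_mulVec, smul_mulVec]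
      rw [this]
      ext x; cases x <;> rfl
    have hrn := LinearMap.finrank_range_add_finrank_ker F.mulVecLin
    have h' : Module.finrank ℂ (LinearMap.range F.mulVecLin) = 2 := by
      rw [Matrix.rank] at h; simpa using h
    rw [h'] at hrn
    simp only [Module.finrank_fintype_fun_eq_card, Fintype.card_fin] at hrn
    have hker : LinearMap.ker F.mulVecLin = ⊥ := Submodule.finrank_eq_zero.1 (by omega)
    have h1 := (LinearMap.ker_eq_bot'.1 hker) _ hk
    have h2 := congrFun h1 j
    simp at h2
  have hrow : ∀ i, C i 0 * a 0 + C i 1 * a 1 = 0 := by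
    intro i
    have := congrFun hCa i
    simpa [mulVec, dotProduct, Fin.sum_univ_two] using this
  obtain ⟨i0, hc0, hc1⟩ : ∃ i, C i 0 ≠ 0 ∧ C i 1 ≠ 0 := by
    have hz0 : ∃ i, C i 0 ≠ 0 := by
      by_contra hcon
      push Not at hcon
      exact hcol 0 (by ext i; simp [hcon i])
    have hz1 : ∃ i, C i 1 ≠ 0 := by
      by_contra hcon
      push Not at hcon
      exact hcol 1 (by ext i; simp [hcon i])
    have ha0 : a 0 ≠ 0 := by
      intro h0
      obtain ⟨i, hi⟩ := hz1
      have := hrow i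
      rw [h0, mul_zero, zero_add] at this
      have h1 := (mul_eq_zero.1 this).resolve_left hi
      exact ha (by ext j; fin_cases j <;> simp [h0, h1])
    obtain ⟨i, hi⟩ := hz0
    refine ⟨i, hi, fun h1 => ?_⟩
    have := hrow i
    rw [h1, zero_mul, add_zero] at this
    exact (mul_ne_zero hi ha0) this
  -- loss probability
  set s : ℝ := 1 - max p 0 with hsdef
  have hs : ∀ k, μ.real {ω | γ k ω ≠ 1} = s := by
    intro k
    have hm : MeasurableSet {ω | γ k ω = 1} := hmeas k (measurableSet_singleton 1)
    have e : {ω | γ k ω ≠ 1} = {ω | γ k ω = 1}ᶜ := by ext; simp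
    rw [e, probReal_compl_eq_one_sub hm, measureReal_def, hber k, ENNReal.toReal_ofReal']
  have hs0 : 0 ≤ s := by rw [← hs 0]; exact measureReal_nonneg
  set y : ℝ := Lam ^ (-(2 * (q : ℝ) / ((q : ℝ) - 1))) with hy
  have hy0 : 0 < y := Real.rpow_pos_of_pos hLam0 _
  have hqm : ((q - 1 : ℕ) : ℝ) = (q : ℝ) - 1 := by push_cast [Nat.cast_sub (show 1 ≤ q by omega)]; ring
  have hqm0 : (q : ℝ) - 1 ≠ 0 := by
    have : (2 : ℝ) ≤ q := by exact_mod_cast hq2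
    intro h; linarith
  have hy1 : y < 1 := by
    apply Real.rpow_lt_one_of_one_lt_of_neg hLam
    have : (2 : ℝ) ≤ q := by exact_mod_cast hq2
    have : 0 < 2 * (q : ℝ) / ((q : ℝ) - 1) := div_pos (by linarith) (by linarith)
    linarith
  have hyp : Lam ^ (2 * q) * y ^ (q - 1) = 1 := by
    rw [hy, ← Real.rpow_natCast (Lam ^ _) (q - 1), ← Real.rpow_mul hLam0.le, hqm,
      ← Real.rpow_natCast, ← Real.rpow_add hLam0]
    have : ((2 * q : ℕ) : ℝ) + -(2 * (q : ℝ) / ((q : ℝ) - 1)) * ((q : ℝ) - 1) = 0 := by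
      push_cast; field_simp; ring
    rw [this, Real.rpow_zero]
  have hLq : 0 < Lam ^ (2 * q) := by positivity
  constructor
  · intro hp S0 hS0
    have hsy : s < y := by
      have := le_max_left p 0
      linarith
    refine upper_main l1 l2 Lam q C Q R hl1 hl2 hLam hq0 hne hQ hR i0 hc0 hc1 μ γ hmeas hind h01 s
      hs0 hs ?_ S0 hS0
    rw [← hyp]
    exact mul_lt_mul_of_pos_left (pow_lt_pow_left₀ hsy hs0 (by omega)) hLq
  · intro hp
    have hsy : y < s := by
      have : max p 0 < 1 - y := max_lt hp (by linarith)
      linarith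
    refine ⟨vecMulVec a (star a), posSemidef_vecMulVec_self_star a,
      lower_main l1 l2 Lam q C Q R hl1 hq0 heq hQ hR a ha hCa μ γ hmeas hind h01 s hs ?_⟩
    rw [← hyp]
    exact mul_lt_mul_of_pos_left (pow_lt_pow_left₀ hsy hy0.le (by omega)) hLq
end
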